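/- arXiv:2510.15118 — 2 statements merged into one kernel-verified Lean document; each statement's English description precedes it below -/
import Mathlib

section
/- Let n ≥ 2 and let A ⊆ ℝ^n be a compact set with dim_H A > (n+1)/2. Then the distance set Δ(A) = { |x − y| : x, y ∈ A } has positive one-dimensional Lebesgue measure. -/
open MeasureTheory
open scoped ENNReal

section Gaussian

variable {V : Type*} [NormedAddCommGroup V] [InnerProductSpace ℝ V] [FiniteDimensional ℝ V]
  [MeasurableSpace V] [BorelSpace V]

theorem integrable_exp_neg_mul_norm_sq {b : ℝ} (hb : 0 < b) :
    Integrable (fun z : V => Real.exp (-b * ‖z‖ ^ 2)) := by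
  have := (GaussianFourier.integrable_cexp_neg_mul_sq_norm_add (V := V) (b := (b : ℂ))
    (by simpa using hb) 0 0).norm
  refine this.congr (Filter.Eventually.of_forall fun z => ?_)
  simp only [Complex.norm_exp]
  congr 1
  simp [← Complex.ofReal_pow]

/-- Fubini for a product of two kernels with Gaussian decay. -/
theorem integral_mul_integral_of_gaussian_bound (μ : Measure V) [IsFiniteMeasure μ]
    {k l : V → V → ℂ} (hk : Measurable (Function.uncurry k)) (hl : Measurable (Function.uncurry l))
    {b M N : ℝ} (hb : 0 < b)
    (hkM : ∀ᵐ y ∂μ, ∀ z, ‖k z y‖ ≤ M * Real.exp (-b * ‖z‖ ^ 2))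
    (hlN : ∀ᵐ y ∂μ, ∀ z, ‖l z y‖ ≤ N * Real.exp (-b * ‖z‖ ^ 2)) :
    Integrable (fun z => (∫ y, k z y ∂μ) * ∫ y, l z y ∂μ) ∧
    ∫ z, (∫ y, k z y ∂μ) * ∫ y, l z y ∂μ = ∫ p, (∫ z, k z p.1 * l z p.2) ∂(μ.prod μ) := by
  have h1 := (Measure.quasiMeasurePreserving_fst (μ := μ) (ν := μ)).ae hkM
  have h2 := (Measure.quasiMeasurePreserving_snd (μ := μ) (ν := μ)).ae hlN
  have h3 := (Measure.quasiMeasurePreserving_snd (μ := (volume : Measure V))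
    (ν := μ.prod μ)).ae (h1.and h2)
  have hint : Integrable (Function.uncurry fun (z : V) (p : V × V) => k z p.1 * l z p.2)
      ((volume : Measure V).prod (μ.prod μ)) := by
    have hdom : Integrable (fun q : V × (V × V) => Real.exp (-(b + b) * ‖q.1‖ ^ 2) * (M * N))
        ((volume : Measure V).prod (μ.prod μ)) :=
      (integrable_exp_neg_mul_norm_sq (by positivity)).mul_prod (integrable_const (M * N))
    refine hdom.mono' ?_ ?_
    · have e1 : Measurable fun q : V × (V × V) => k q.1 q.2.1 :=
        hk.comp (by fun_prop : Measurable fun q : V × (V × V) => (q.1, q.2.1))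
      have e2 : Measurable fun q : V × (V × V) => l q.1 q.2.2 :=
        hl.comp (by fun_prop : Measurable fun q : V × (V × V) => (q.1, q.2.2))
      exact (e1.mul e2).aestronglyMeasurable
    · filter_upwards [h3] with q hq
      simp only [Function.uncurry, norm_mul]
      refine (mul_le_mul (hq.1 q.1) (hq.2 q.1) (norm_nonneg _)
        ((norm_nonneg _).trans (hq.1 q.1))).trans_eq ?_
      rw [neg_add, add_mul, Real.exp_add]
      ring
  have he : ∀ z, (∫ y, k z y ∂μ) * ∫ y, l z y ∂μ = ∫ p, k z p.1 * l z p.2 ∂(μ.prod μ) :=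
    fun z => (integral_prod_mul _ _).symm
  simp_rw [he]
  exact ⟨hint.integral_prod_left, integral_integral_swap hint⟩

theorem integral_norm_sq_of_gaussian_bound (μ : Measure V) [IsFiniteMeasure μ]
    {k : V → V → ℂ} (hk : Measurable (Function.uncurry k)) {b M : ℝ} (hb : 0 < b)
    (hkM : ∀ᵐ y ∂μ, ∀ z, ‖k z y‖ ≤ M * Real.exp (-b * ‖z‖ ^ 2)) :
    Integrable (fun z => ‖∫ y, k z y ∂μ‖ ^ 2) ∧
    ((∫ z, ‖∫ y, k z y ∂μ‖ ^ 2 : ℝ) : ℂ) =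
      ∫ p, (∫ z, k z p.1 * (starRingEnd ℂ) (k z p.2)) ∂(μ.prod μ) := by
  have h := integral_mul_integral_of_gaussian_bound μ hk
    (l := fun z y => (starRingEnd ℂ) (k z y))
    ((continuous_star (R := ℂ)).measurable.comp hk) hb hkM (by simpa using hkM)
  have he : ∀ z, (∫ y, k z y ∂μ) * ∫ y, (starRingEnd ℂ) (k z y) ∂μ =
      ((‖∫ y, k z y ∂μ‖ ^ 2 : ℝ) : ℂ) := by
    intro z
    rw [integral_conj, Complex.mul_conj']
    push_cast
    rfl
  simp_rw [he] at h
  refine ⟨?_, ?_⟩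
  · simpa only [RCLike.re_to_complex, Complex.ofReal_re] using h.1.re
  · rw [← h.2, integral_complex_ofReal]

theorem integral_norm_sq_le_of_gaussian_bound (μ : Measure V) [IsFiniteMeasure μ]
    {k : V → V → ℂ} (hk : Measurable (Function.uncurry k)) {b M : ℝ} (hb : 0 < b)
    (hkM : ∀ᵐ y ∂μ, ∀ z, ‖k z y‖ ≤ M * Real.exp (-b * ‖z‖ ^ 2)) {H : V × V → ℝ}
    (hH : Integrable H (μ.prod μ))
    (hkH : ∀ᵐ p ∂(μ.prod μ), ‖∫ z, k z p.1 * (starRingEnd ℂ) (k z p.2)‖ ≤ H p) :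
    ∫ z, ‖∫ y, k z y ∂μ‖ ^ 2 ≤ ∫ p, H p ∂(μ.prod μ) := by
  have h0 : 0 ≤ ∫ z, ‖∫ y, k z y ∂μ‖ ^ 2 := integral_nonneg fun z => by positivity
  rw [← Real.norm_of_nonneg h0, ← Complex.norm_real,
    (integral_norm_sq_of_gaussian_bound μ hk hb hkM).2]
  exact norm_integral_le_of_norm_le hH hkH

theorem integral_cexp_neg_mul_norm_sq_add_I_mul_inner {b : ℝ} (hb : 0 < b) (τ : ℝ) (w : V) :
    ∫ z : V, Complex.exp (-(b : ℂ) * (‖z‖ : ℂ) ^ 2 + (Complex.I * τ) * (inner ℝ w z : ℝ)) =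
      (((Real.pi / b) ^ ((Module.finrank ℝ V : ℝ) / 2) *
          Real.exp (-(τ ^ 2 * ‖w‖ ^ 2) / (4 * b)) : ℝ) : ℂ) := by
  rw [GaussianFourier.integral_cexp_neg_mul_sq_norm_add (by simpa using hb)]
  push_cast
  rw [Complex.ofReal_cpow (by positivity)]
  push_cast
  congr 2
  rw [mul_pow, Complex.I_sq]
  ring

theorem integrable_exp_neg_mul_norm_sub_sq (μ : Measure V) [IsFiniteMeasure μ] {b : ℝ}
    (hb : 0 ≤ b) :
    Integrable (fun p : V × V => Real.exp (-(b * ‖p.1 - p.2‖ ^ 2))) (μ.prod μ) := by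
  refine Integrable.mono' (integrable_const (1 : ℝ)) (by fun_prop) ?_
  refine Filter.Eventually.of_forall fun p => ?_
  rw [Real.norm_of_nonneg (Real.exp_nonneg _), Real.exp_le_one_iff]
  have : 0 ≤ b * ‖p.1 - p.2‖ ^ 2 := by positivity
  linarith

/-- The `L²` norm of the Fourier transform of `ν` against a Gaussian weight. -/
theorem integral_gaussian_mul_norm_sq_fourier (ν : Measure V) [IsFiniteMeasure ν]
    {b : ℝ} (hb : 0 < b) :
    ∫ z, ‖∫ y, Complex.exp (-(b : ℂ) * (‖z‖ : ℂ) ^ 2 + Complex.I * (inner ℝ y z : ℝ)) ∂ν‖ ^ 2 =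
      (Real.pi / (2 * b)) ^ ((Module.finrank ℝ V : ℝ) / 2) *
        ∫ p, Real.exp (-(1 / (8 * b) * ‖p.1 - p.2‖ ^ 2)) ∂(ν.prod ν) := by
  have h := (integral_norm_sq_of_gaussian_bound ν (b := b) (M := 1) (k := fun z y =>
    Complex.exp (-(b : ℂ) * (‖z‖ : ℂ) ^ 2 + Complex.I * (inner ℝ y z : ℝ)))
    (Continuous.measurable (by fun_prop)) hb (Filter.Eventually.of_forall fun y z => by
      rw [Complex.norm_exp]
      simp [← Complex.ofReal_pow])).2
  apply Complex.ofReal_injective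
  rw [h, ← integral_const_mul, ← integral_complex_ofReal]
  refine integral_congr_ae (Filter.Eventually.of_forall fun p => ?_)
  have e := integral_cexp_neg_mul_norm_sq_add_I_mul_inner (V := V) (b := 2 * b)
    (by positivity) 1 (p.1 - p.2)
  simp only
  convert e using 1
  · refine integral_congr_ae (Filter.Eventually.of_forall fun z => ?_)
    simp only [← Complex.exp_conj, ← Complex.exp_add]
    congr 1
    simp [inner_sub_left]
    ring
  · congr 3
    field_simp
    ring

theorem norm_integral_cexp_norm_sub_sq_le (μ : Measure V) [IsFiniteMeasure μ] {R : ℝ}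
    (hR : ∀ᵐ x ∂μ, ‖x‖ ≤ R) {t : ℝ} (ht : 2 ≤ t) :
    ‖∫ p, Complex.exp (Complex.I * t * (‖p.1 - p.2‖ : ℂ) ^ 2) ∂(μ.prod μ)‖ ≤
      Real.exp (4 * R ^ 2) * t ^ ((Module.finrank ℝ V : ℝ) / 2) *
        ∫ p, Real.exp (-(t ^ 2 / 4 * ‖p.1 - p.2‖ ^ 2)) ∂(μ.prod μ) := by
  set N : ℝ := (Module.finrank ℝ V : ℝ) / 2 with hN
  have hN0 : 0 ≤ N := by positivity
  set Q := ∫ p, Real.exp (-(t ^ 2 / 4 * ‖p.1 - p.2‖ ^ 2)) ∂(μ.prod μ) with hQ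
  have hQ0 : 0 ≤ Q := integral_nonneg fun _ => Real.exp_nonneg _
  have ht0 : 0 < t := by linarith
  have ht4 : 4 ≤ t ^ 2 := by nlinarith
  have hR' : ∀ᵐ x ∂μ, ‖x‖ ^ 2 ≤ R ^ 2 := by
    filter_upwards [hR] with x hx
    gcongr
  have hR1 := (Measure.quasiMeasurePreserving_fst (μ := μ) (ν := μ)).ae hR'
  have hR2 := (Measure.quasiMeasurePreserving_snd (μ := μ) (ν := μ)).ae hR'
  have hsq : ∀ z x : V, ‖z‖ ^ 2 ≤ 2 * ‖z - x‖ ^ 2 + 2 * ‖x‖ ^ 2 := by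
    intro z x
    have h1 : ‖z‖ ≤ ‖z - x‖ + ‖x‖ := by simpa using norm_add_le (z - x) x
    have h2 : ‖z‖ ^ 2 ≤ (‖z - x‖ + ‖x‖) ^ 2 := by gcongr
    nlinarith [sq_nonneg (‖z - x‖ - ‖x‖)]
  set k : V → V → ℂ := fun z x => Complex.exp (Complex.I * t * (‖x‖ : ℂ) ^ 2 -
    (t : ℂ) ^ 2 * (‖z - x‖ : ℂ) ^ 2 + (‖z‖ : ℂ) ^ 2) with hk
  set l : V → V → ℂ := fun z y => Complex.exp ((1 + Complex.I * t) * (‖y‖ : ℂ) ^ 2 -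
    (‖z‖ : ℂ) ^ 2 + Complex.I * (-2 * t : ℝ) * (inner ℝ y z : ℝ)) with hl
  have hkm : Measurable (Function.uncurry k) := Continuous.measurable (by fun_prop)
  have hlm : Measurable (Function.uncurry l) := Continuous.measurable (by fun_prop)
  have hkn : ∀ z x, ‖k z x‖ = Real.exp (-(t ^ 2 * ‖z - x‖ ^ 2) + ‖z‖ ^ 2) := by
    intro z x
    rw [hk, Complex.norm_exp]
    simp [← Complex.ofReal_pow]
  have hln : ∀ z x, ‖l z x‖ = Real.exp (‖x‖ ^ 2 - ‖z‖ ^ 2) := by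
    intro z x
    rw [hl, Complex.norm_exp]
    simp [← Complex.ofReal_pow]
  have hkM : ∀ᵐ y ∂μ, ∀ z, ‖k z y‖ ≤ Real.exp (4 * R ^ 2) * Real.exp (-1 * ‖z‖ ^ 2) := by
    filter_upwards [hR'] with y hy z
    rw [hkn, ← Real.exp_add, Real.exp_le_exp]
    nlinarith [hsq z y, sq_nonneg ‖z - y‖]
  have hlM : ∀ᵐ y ∂μ, ∀ z, ‖l z y‖ ≤ Real.exp (R ^ 2) * Real.exp (-1 * ‖z‖ ^ 2) := by
    filter_upwards [hR'] with y hy z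
    rw [hln, ← Real.exp_add, Real.exp_le_exp]
    linarith
  have hexp : Integrable (fun p : V × V => Real.exp (-(t ^ 2 / 4 * ‖p.1 - p.2‖ ^ 2)))
    (μ.prod μ) := integrable_exp_neg_mul_norm_sub_sq μ (by positivity)
  have hP : ∫ z, ‖∫ y, k z y ∂μ‖ ^ 2 ≤
      Real.exp (4 * R ^ 2) * (Real.pi / t ^ 2) ^ N * Q := by
    rw [hQ, ← integral_const_mul]
    refine integral_norm_sq_le_of_gaussian_bound μ hkm one_pos hkM (hexp.const_mul _) ?_
    filter_upwards [hR1, hR2] with p h1 h2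
    have hg := integrable_exp_neg_mul_norm_sq (V := V) (b := t ^ 2) (by positivity)
    have hi := GaussianFourier.integral_rexp_neg_mul_sq_norm (V := V) (b := t ^ 2) (by positivity)
    rw [← integral_sub_right_eq_self _ ((1 / 2 : ℝ) • (p.1 + p.2))] at hi
    rw [mul_assoc, mul_comm (_ ^ N), ← hi, ← mul_assoc, ← integral_const_mul]
    refine norm_integral_le_of_norm_le
      ((hg.comp_sub_right ((1 / 2 : ℝ) • (p.1 + p.2))).const_mul _)
      (Filter.Eventually.of_forall fun z => ?_)
    rw [norm_mul, RCLike.norm_conj, hkn, hkn, ← Real.exp_add, ← Real.exp_add, ← Real.exp_add,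
      Real.exp_le_exp]
    have e1 : ‖z - p.1‖ ^ 2 + ‖z - p.2‖ ^ 2 =
        2 * ‖z - (1 / 2 : ℝ) • (p.1 + p.2)‖ ^ 2 + 1 / 2 * ‖p.1 - p.2‖ ^ 2 := by
      have := parallelogram_law_with_norm ℝ (z - p.1) (z - p.2)
      have e2 : z - p.1 + (z - p.2) = (2 : ℝ) • (z - (1 / 2 : ℝ) • (p.1 + p.2)) := by module
      have e3 : z - p.1 - (z - p.2) = -(p.1 - p.2) := by abel
      rw [e2, e3, norm_neg, norm_smul, Real.norm_ofNat] at this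
      nlinarith
    nlinarith [hsq z p.1, hsq z p.2, sq_nonneg ‖z - p.1‖, sq_nonneg ‖z - p.2‖]
  have hW : ∫ z, ‖∫ y, l z y ∂μ‖ ^ 2 ≤ Real.exp (4 * R ^ 2) * Real.pi ^ N * Q := by
    rw [hQ, ← integral_const_mul]
    refine integral_norm_sq_le_of_gaussian_bound μ hlm one_pos hlM (hexp.const_mul _) ?_
    filter_upwards [hR1, hR2] with p h1 h2
    have e : ∀ z, l z p.1 * (starRingEnd ℂ) (l z p.2) =
        Complex.exp ((1 + Complex.I * t) * (‖p.1‖ : ℂ) ^ 2 +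
          (1 - Complex.I * t) * (‖p.2‖ : ℂ) ^ 2) *
        Complex.exp (-((2 : ℝ) : ℂ) * (‖z‖ : ℂ) ^ 2 +
          (Complex.I * (-2 * t : ℝ)) * (inner ℝ (p.1 - p.2) z : ℝ)) := by
      intro z
      simp only [hl, ← Complex.exp_conj, ← Complex.exp_add]
      congr 1
      simp [inner_sub_left, Complex.conj_ofNat]
      ring
    simp_rw [e]
    rw [integral_const_mul, integral_cexp_neg_mul_norm_sq_add_I_mul_inner two_pos, norm_mul,
      Complex.norm_exp, Complex.norm_real, Real.norm_of_nonneg (by positivity), mul_assoc]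
    gcongr
    · have : ((1 + Complex.I * t) * (‖p.1‖ : ℂ) ^ 2 +
          (1 - Complex.I * t) * (‖p.2‖ : ℂ) ^ 2).re = ‖p.1‖ ^ 2 + ‖p.2‖ ^ 2 := by
        simp [← Complex.ofReal_pow]
      rw [this]
      nlinarith [sq_nonneg R]
    · linarith [Real.pi_pos]
    · nlinarith [sq_nonneg (t * ‖p.1 - p.2‖)]
  have hE : ∫ p, (∫ z, k z p.1 * l z p.2) ∂(μ.prod μ) = (((Real.pi / t ^ 2) ^ N : ℝ) : ℂ) *
      ∫ p, Complex.exp (Complex.I * t * (‖p.1 - p.2‖ : ℂ) ^ 2) ∂(μ.prod μ) := by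
    rw [← integral_const_mul]
    refine integral_congr_ae (Filter.Eventually.of_forall fun p => ?_)
    simp only
    rw [← integral_add_right_eq_self _ p.1]
    have e : ∀ z, k (z + p.1) p.1 * l (z + p.1) p.2 =
        Complex.exp (Complex.I * t * (‖p.1‖ : ℂ) ^ 2 + (1 + Complex.I * t) * (‖p.2‖ : ℂ) ^ 2 -
          2 * Complex.I * t * (inner ℝ p.2 p.1 : ℝ)) *
        Complex.exp (-((t ^ 2 : ℝ) : ℂ) * (‖z‖ : ℂ) ^ 2 +
          (Complex.I * (-2 * t : ℝ)) * (inner ℝ p.2 z : ℝ)) := by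
      intro z
      simp only [hk, hl, ← Complex.exp_add]
      congr 1
      simp [inner_add_right]
      ring
    simp_rw [e]
    rw [integral_const_mul, integral_cexp_neg_mul_norm_sq_add_I_mul_inner (by positivity)]
    rw [Complex.ofReal_mul, mul_left_comm, Complex.ofReal_exp, ← Complex.exp_add]
    congr 2
    rw [← Complex.ofReal_pow ‖p.1 - p.2‖, norm_sub_sq_real, real_inner_comm]
    have ht' : (t : ℂ) ≠ 0 := by exact_mod_cast ht0.ne'
    push_cast
    field_simp
    ring
  have hB := integral_mul_integral_of_gaussian_bound μ hkm hlm one_pos hkM hlM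
  have hPi := (integral_norm_sq_of_gaussian_bound μ hkm one_pos hkM).1
  have hWi := (integral_norm_sq_of_gaussian_bound μ hlm one_pos hlM).1
  have htN : 0 < t ^ N := by positivity
  have hpt : (Real.pi / t ^ 2) ^ N = Real.pi ^ N / (t ^ N * t ^ N) := by
    rw [Real.div_rpow Real.pi_pos.le (by positivity), sq, Real.mul_rpow ht0.le ht0.le]
  have hpi : 0 < Real.pi ^ N := by positivity
  have hmain : (Real.pi / t ^ 2) ^ N *
      ‖∫ p, Complex.exp (Complex.I * t * (‖p.1 - p.2‖ : ℂ) ^ 2) ∂(μ.prod μ)‖ ≤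
      1 / 2 * (t ^ N * (Real.exp (4 * R ^ 2) * (Real.pi / t ^ 2) ^ N * Q) +
        (t ^ N)⁻¹ * (Real.exp (4 * R ^ 2) * Real.pi ^ N * Q)) := by
    have h1 : 0 ≤ (Real.pi / t ^ 2) ^ N := by positivity
    rw [← Real.norm_of_nonneg h1, ← Complex.norm_real, ← norm_mul, ← hE, ← hB.2,
      Complex.norm_real, Real.norm_of_nonneg h1]
    calc _ ≤ ∫ z, 1 / 2 * (t ^ N * ‖∫ y, k z y ∂μ‖ ^ 2 + (t ^ N)⁻¹ * ‖∫ y, l z y ∂μ‖ ^ 2) := by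
          refine norm_integral_le_of_norm_le (((hPi.const_mul _).add (hWi.const_mul _)).const_mul _)
            (Filter.Eventually.of_forall fun z => ?_)
          rw [norm_mul]
          generalize ‖∫ y, k z y ∂μ‖ = a
          generalize ‖∫ y, l z y ∂μ‖ = c
          have h2 : t ^ N * a ^ 2 + (t ^ N)⁻¹ * c ^ 2 - 2 * (a * c) =
              (t ^ N)⁻¹ * (t ^ N * a - c) ^ 2 := by
            field_simp
            ring
          have h3 : 0 ≤ (t ^ N)⁻¹ * (t ^ N * a - c) ^ 2 := by positivity
          linarith
      _ = 1 / 2 * (t ^ N * ∫ z, ‖∫ y, k z y ∂μ‖ ^ 2) +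
          1 / 2 * ((t ^ N)⁻¹ * ∫ z, ‖∫ y, l z y ∂μ‖ ^ 2) := by
          rw [integral_const_mul, integral_add (hPi.const_mul _) (hWi.const_mul _),
            integral_const_mul, integral_const_mul, mul_add]
      _ ≤ _ := by
          rw [← mul_add]
          gcongr
  rw [hpt] at hmain
  refine le_of_mul_le_mul_left (hmain.trans_eq ?_) (by positivity :
    0 < Real.pi ^ N / (t ^ N * t ^ N))
  field_simp
  ring

end Gaussian

theorem exists_integral_gaussian_le_of_ball_bound {V : Type*} [NormedAddCommGroup V]
    [MeasurableSpace V] [BorelSpace V] [SecondCountableTopology V] (s : ℝ) :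
    ∃ K : ℝ, 0 ≤ K ∧ ∀ (μ : Measure V) [IsFiniteMeasure μ] (C τ : ℝ), 0 ≤ C → 0 < τ →
      (∀ x r, τ⁻¹ ≤ r → μ (Metric.ball x r) ≤ ENNReal.ofReal (C * r ^ s)) →
      ∫ p, Real.exp (-(τ ^ 2 * ‖p.1 - p.2‖ ^ 2)) ∂(μ.prod μ) ≤
        μ.real Set.univ * (C * K * (τ ^ s)⁻¹) := by
  have hsum : Summable fun j : ℕ => Real.exp (-j) * ((j : ℝ) + 1) ^ s := by
    have h1 := Real.summable_pow_mul_exp_neg_nat_mul ⌈s⌉₊ one_pos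
    have h2 := ((summable_nat_add_iff 1).2 h1).mul_left (Real.exp 1)
    refine Summable.of_nonneg_of_le (fun j => by positivity) (fun j => ?_) h2
    have h3 : ((j : ℝ) + 1) ^ s ≤ ((j : ℝ) + 1) ^ ⌈s⌉₊ := by
      rw [← Real.rpow_natCast]
      exact Real.rpow_le_rpow_of_exponent_le (by linarith [(Nat.cast_nonneg j : (0 : ℝ) ≤ j)])
        (Nat.le_ceil s)
    calc Real.exp (-j) * ((j : ℝ) + 1) ^ s ≤ Real.exp (-j) * ((j : ℝ) + 1) ^ ⌈s⌉₊ := by gcongr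
      _ = _ := by
        rw [mul_left_comm, ← Real.exp_add]
        push_cast
        ring_nf
  refine ⟨∑' j : ℕ, Real.exp (-j) * ((j : ℝ) + 1) ^ s, tsum_nonneg fun j => by positivity, ?_⟩
  intro μ _ C τ hC hτ hμ
  have hpt : ∀ x y : V, ENNReal.ofReal (Real.exp (-(τ ^ 2 * ‖x - y‖ ^ 2))) ≤
      ∑' j : ℕ, ENNReal.ofReal (Real.exp (-j)) *
        (Metric.ball x (((j : ℝ) + 1) * τ⁻¹)).indicator 1 y := by
    intro x y
    set j := ⌊τ * ‖x - y‖⌋₊ with hj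
    refine le_trans ?_ (ENNReal.le_tsum j)
    have h1 : (j : ℝ) ≤ τ * ‖x - y‖ := Nat.floor_le (by positivity)
    have h2 : τ * ‖x - y‖ < j + 1 := Nat.lt_floor_add_one _
    rw [Set.indicator_of_mem, Pi.one_apply, mul_one]
    · refine ENNReal.ofReal_le_ofReal (Real.exp_le_exp.2 ?_)
      rw [neg_le_neg_iff, ← mul_pow]
      have h3 : (j : ℝ) ≤ (j : ℝ) ^ 2 := by exact_mod_cast Nat.le_self_pow two_ne_zero j
      exact h3.trans (by gcongr)
    · rw [Metric.mem_ball, dist_comm, dist_eq_norm, ← div_eq_mul_inv, lt_div_iff₀' hτ]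
      exact h2
  have hin : ∀ x : V, ∫⁻ y, ENNReal.ofReal (Real.exp (-(τ ^ 2 * ‖x - y‖ ^ 2))) ∂μ ≤
      ENNReal.ofReal (C * (∑' j : ℕ, Real.exp (-j) * ((j : ℝ) + 1) ^ s) * (τ ^ s)⁻¹) := by
    intro x
    calc _ ≤ ∫⁻ y, ∑' j : ℕ, ENNReal.ofReal (Real.exp (-j)) *
        (Metric.ball x (((j : ℝ) + 1) * τ⁻¹)).indicator 1 y ∂μ := lintegral_mono fun y => hpt x y
      _ = ∑' j : ℕ, ENNReal.ofReal (Real.exp (-j)) * μ (Metric.ball x (((j : ℝ) + 1) * τ⁻¹)) := by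
        rw [lintegral_tsum fun j => by
          exact ((measurable_one.indicator Metric.isOpen_ball.measurableSet).const_mul
            _).aemeasurable]
        congr 1
        funext j
        rw [lintegral_const_mul _ (measurable_one.indicator Metric.isOpen_ball.measurableSet),
          lintegral_indicator_one Metric.isOpen_ball.measurableSet]
      _ ≤ ∑' j : ℕ, ENNReal.ofReal (C * (Real.exp (-j) * ((j : ℝ) + 1) ^ s) * (τ ^ s)⁻¹) := by
        refine ENNReal.tsum_le_tsum fun j => ?_
        have hj : τ⁻¹ ≤ ((j : ℝ) + 1) * τ⁻¹ := by
          have : 0 ≤ (j : ℝ) * τ⁻¹ := by positivity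
          linarith
        refine (mul_le_mul_right (hμ x _ hj) _).trans_eq ?_
        rw [← ENNReal.ofReal_mul (Real.exp_nonneg _), Real.mul_rpow (by positivity)
          (by positivity), Real.inv_rpow hτ.le]
        ring_nf
      _ = _ := by
        rw [← tsum_mul_left, ← tsum_mul_right, ENNReal.ofReal_tsum_of_nonneg
          (fun j => by positivity) ((hsum.mul_left C).mul_right _)]
  rw [integral_eq_lintegral_of_nonneg_ae (Filter.Eventually.of_forall fun p => Real.exp_nonneg _)
    (Continuous.aestronglyMeasurable (by fun_prop))]
  refine ENNReal.toReal_le_of_le_ofReal (mul_nonneg measureReal_nonneg (by positivity)) ?_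
  rw [lintegral_prod _ (Measurable.aemeasurable (by fun_prop))]
  calc _ ≤ ∫⁻ x : V, ENNReal.ofReal
        (C * (∑' j : ℕ, Real.exp (-j) * ((j : ℝ) + 1) ^ s) * (τ ^ s)⁻¹) ∂μ :=
        lintegral_mono hin
    _ = _ := by
      rw [lintegral_const, ENNReal.ofReal_mul measureReal_nonneg, mul_comm, ofReal_measureReal]

theorem sq_measure_univ_le_of_prod_le {K : Set ℝ} (ν : Measure ℝ) [IsFiniteMeasure ν]
    (hν : ν Kᶜ = 0) {ε : ℝ} (hε : 0 < ε) {C : ℝ≥0∞}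
    (hC : ν.prod ν {p | |p.1 - p.2| ≤ 2 * ε} ≤ C * ENNReal.ofReal ε) :
    ν Set.univ ^ 2 ≤ C * volume (Metric.cthickening ε K) := by
  set δ := ENNReal.ofReal ε with hδ
  have hδ0 : δ ≠ 0 := by simpa [hδ] using hε
  have hδt : δ ≠ ⊤ := ENNReal.ofReal_ne_top
  have hvol : ∀ u : ℝ, volume (Metric.closedBall u ε) = 2 * δ := fun u => by
    rw [Real.volume_closedBall, ENNReal.ofReal_mul zero_le_two]
    simp [hδ]
  have hmeas1 : MeasurableSet {q : ℝ × ℝ | |q.1 - q.2| ≤ ε} :=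
    (isClosed_le (by fun_prop) continuous_const).measurableSet
  have hmeas2 : MeasurableSet {q : ℝ × (ℝ × ℝ) | |q.1 - q.2.1| ≤ ε ∧ |q.1 - q.2.2| ≤ ε} :=
    .inter (isClosed_le (f := fun q : ℝ × (ℝ × ℝ) => |q.1 - q.2.1|) (by fun_prop)
        continuous_const).measurableSet
      (isClosed_le (f := fun q : ℝ × (ℝ × ℝ) => |q.1 - q.2.2|) (by fun_prop)
        continuous_const).measurableSet
  have hball : ∀ s : ℝ, Metric.closedBall s ε = Prod.mk s ⁻¹' {q : ℝ × ℝ | |q.1 - q.2| ≤ ε} := by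
    intro s
    ext u
    simp [Real.dist_eq, abs_sub_comm]
  have hfm : Measurable fun s => ν (Metric.closedBall s ε) := by
    simp_rw [hball]
    exact measurable_measure_prodMk_left hmeas1
  have hint1 : ∫⁻ s, ν (Metric.closedBall s ε) = 2 * δ * ν Set.univ := by
    simp_rw [hball]
    rw [← Measure.prod_apply hmeas1, Measure.prod_apply_symm hmeas1, ← lintegral_const]
    refine lintegral_congr fun u => ?_
    rw [← hvol u]
    rfl
  have hint2 : ∫⁻ s, ν (Metric.closedBall s ε) ^ 2 ≤ 2 * δ * (C * δ) := by
    have h1 : ∀ s : ℝ, ν (Metric.closedBall s ε) ^ 2 = ν.prod ν (Prod.mk s ⁻¹'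
        {q : ℝ × (ℝ × ℝ) | |q.1 - q.2.1| ≤ ε ∧ |q.1 - q.2.2| ≤ ε}) := by
      intro s
      rw [sq, ← Measure.prod_prod]
      congr 1
      ext p
      simp [Real.dist_eq, abs_sub_comm]
    simp_rw [h1]
    rw [← Measure.prod_apply hmeas2, Measure.prod_apply_symm hmeas2]
    have hm3 : MeasurableSet {p : ℝ × ℝ | |p.1 - p.2| ≤ 2 * ε} :=
      (isClosed_le (by fun_prop) continuous_const).measurableSet
    calc _ ≤ ∫⁻ p : ℝ × ℝ, {p : ℝ × ℝ | |p.1 - p.2| ≤ 2 * ε}.indicator (fun _ => 2 * δ) p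
          ∂(ν.prod ν) := by
          refine lintegral_mono fun p => ?_
          by_cases hp : |p.1 - p.2| ≤ 2 * ε
          · rw [Set.indicator_of_mem (show p ∈ {p : ℝ × ℝ | |p.1 - p.2| ≤ 2 * ε} from hp),
              ← hvol p.1]
            refine measure_mono fun s hs => ?_
            exact hs.1
          · rw [Set.indicator_of_notMem (show p ∉ {p : ℝ × ℝ | |p.1 - p.2| ≤ 2 * ε} from hp),
              nonpos_iff_eq_zero]
            convert measure_empty (μ := (volume : Measure ℝ))
            refine Set.eq_empty_of_forall_notMem fun s hs => hp ?_
            have h1 : |s - p.1| ≤ ε := hs.1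
            have h2 : |s - p.2| ≤ ε := hs.2
            rw [abs_le] at *
            constructor <;> linarith [h1.1, h1.2, h2.1, h2.2]
      _ = 2 * δ * ν.prod ν {p | |p.1 - p.2| ≤ 2 * ε} := lintegral_indicator_const hm3 _
      _ ≤ _ := by gcongr
  have hsupp : ∀ s, ν (Metric.closedBall s ε) =
      ν (Metric.closedBall s ε) * (Metric.cthickening ε K).indicator 1 s := by
    intro s
    by_cases hs : s ∈ Metric.cthickening ε K
    · simp [hs]
    · rw [Set.indicator_of_notMem hs, mul_zero]
      have hsub : Metric.closedBall s ε ⊆ Kᶜ := fun u hu huK =>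
        hs (Metric.mem_cthickening_of_dist_le s u ε K huK (by
          rwa [dist_comm, ← Metric.mem_closedBall]))
      exact measure_mono_null hsub hν
  have hKm : MeasurableSet (Metric.cthickening ε K) := Metric.isClosed_cthickening.measurableSet
  have hCS := ENNReal.lintegral_mul_le_Lp_mul_Lq (volume : Measure ℝ) Real.HolderConjugate.two_two
    hfm.aemeasurable ((measurable_one (α := ℝ≥0∞)).indicator hKm).aemeasurable
  have hind : ∀ s, (Metric.cthickening ε K).indicator (1 : ℝ → ℝ≥0∞) s ^ (2 : ℝ) =
      (Metric.cthickening ε K).indicator 1 s := by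
    intro s
    by_cases hs : s ∈ Metric.cthickening ε K <;> simp [hs]
  simp only [Pi.mul_apply, ← hsupp, hint1, hind, lintegral_indicator_one hKm,
    ENNReal.rpow_two] at hCS
  have hsq := pow_le_pow_left' hCS 2
  have hhalf : ∀ a : ℝ≥0∞, (a ^ (1 / 2 : ℝ)) ^ 2 = a := fun a => by
    rw [← ENNReal.rpow_natCast, ← ENNReal.rpow_mul]
    norm_num
  rw [mul_pow (_ ^ (1 / 2 : ℝ)), hhalf, hhalf] at hsq
  have h4 : (2 * δ) * (2 * δ) * ν Set.univ ^ 2 ≤ (2 * δ) * (2 * δ) *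
      (C * volume (Metric.cthickening ε K)) := by
    calc _ = (2 * δ * ν Set.univ) ^ 2 := by ring
      _ ≤ _ := hsq
      _ ≤ 2 * δ * (C * δ) * volume (Metric.cthickening ε K) := by gcongr
      _ ≤ 2 * δ * (C * (2 * δ)) * volume (Metric.cthickening ε K) := by
        gcongr
        exact le_mul_of_one_le_left zero_le one_le_two
      _ = _ := by ring
  have h20 : (2 * δ) * (2 * δ) ≠ 0 := by simp [hδ0]
  have h2t : (2 * δ) * (2 * δ) ≠ ⊤ := by finiteness
  exact (ENNReal.mul_le_mul_iff_right h20 h2t).1 h4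

theorem volume_pos_of_forall_exists_measure {K : Set ℝ} (hK : IsCompact K) {m C : ℝ≥0∞}
    (hm : m ≠ 0) (hC : C ≠ ⊤)
    (h : ∀ ε : ℝ, 0 < ε → ∃ ν : Measure ℝ, IsFiniteMeasure ν ∧ ν Kᶜ = 0 ∧ ν Set.univ = m ∧
      ν.prod ν {p | |p.1 - p.2| ≤ 2 * ε} ≤ C * ENNReal.ofReal ε) :
    0 < volume K := by
  have h1 : m ^ 2 ≤ C * volume K := by
    have ht : Filter.Tendsto (fun ε => C * volume (Metric.cthickening ε K))
        (nhdsWithin 0 (Set.Ioi 0)) (nhds (C * volume K)) :=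
      ENNReal.Tendsto.const_mul
        ((tendsto_measure_cthickening_of_isCompact hK).mono_left nhdsWithin_le_nhds) (Or.inr hC)
    refine ge_of_tendsto ht ?_
    filter_upwards [self_mem_nhdsWithin] with ε hε
    obtain ⟨ν, hfin, h0, hu, hp⟩ := h ε hε
    rw [← hu]
    exact sq_measure_univ_le_of_prod_le ν h0 hε hp
  refine pos_iff_ne_zero.2 fun h0 => hm ?_
  rw [h0, mul_zero, nonpos_iff_eq_zero] at h1
  exact pow_eq_zero_iff two_ne_zero |>.1 h1

section Frostman

theorem measure_eq_zero_of_boundedBy_ediam_rpow_eq_zero {X : Type*} [EMetricSpace X]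
    [MeasurableSpace X] [BorelSpace X] {s : ℝ} (hs : 0 < s) {A : Set X}
    (hA : OuterMeasure.boundedBy (fun S : Set X => Metric.ediam S ^ s) A = 0) :
    μH[s] A = 0 := by
  rw [← nonpos_iff_eq_zero, Measure.hausdorffMeasure_apply]
  refine iSup₂_le fun r hr => ?_
  refine le_of_forall_gt_imp_ge_of_dense fun η hη => ?_
  have hr' : 0 < r ^ s := by
    rcases eq_or_ne r ⊤ with rfl | h
    · simp [hs]
    · exact ENNReal.rpow_pos hr h
  have h : OuterMeasure.boundedBy (fun S : Set X => Metric.ediam S ^ s) A < min η (r ^ s) := by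
    rw [hA]
    exact lt_min hη hr'
  rw [OuterMeasure.boundedBy_apply] at h
  simp only [iInf_lt_iff] at h
  obtain ⟨t, ht, hlt⟩ := h
  refine (iInf₂_le_of_le t ht (iInf_le_of_le (fun n => ?_) le_rfl)).trans
    (hlt.le.trans (min_le_left _ _))
  rcases (t n).eq_empty_or_nonempty with h0 | h0
  · simp [h0]
  · have h1 : Metric.ediam (t n) ^ s ≤ r ^ s := by
      refine le_trans ?_ (hlt.le.trans (min_le_right _ _))
      refine le_trans ?_ (ENNReal.le_tsum n)
      exact le_iSup_of_le h0 le_rfl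
    exact (ENNReal.rpow_le_rpow_iff hs).1 h1

theorem exists_sum_eq_of_le_sum {ι : Type*} (t : Finset ι) (g : ι → ℝ≥0∞) :
    ∀ m, m ≤ ∑ i ∈ t, g i → ∃ f : ι → ℝ≥0∞, (∀ i, f i ≤ g i) ∧ ∑ i ∈ t, f i = m := by
  classical
  induction t using Finset.induction_on with
  | empty => exact fun m hm => ⟨fun _ => 0, by simp, by simpa [eq_comm] using hm⟩
  | insert a t ha ih =>
    intro m hm
    rw [Finset.sum_insert ha] at hm
    obtain ⟨f, hf, hfs⟩ := ih (m - min m (g a)) (by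
      rw [tsub_le_iff_right]
      rcases le_total m (g a) with h | h
      · simp [h]
      · rw [min_eq_right h, add_comm]
        exact hm)
    refine ⟨Function.update f a (min m (g a)), fun i => ?_, ?_⟩
    · rcases eq_or_ne i a with rfl | h
      · simp
      · simpa [h] using hf i
    · rw [Finset.sum_insert ha, Function.update_self]
      have : ∑ i ∈ t, Function.update f a (min m (g a)) i = ∑ i ∈ t, f i :=
        Finset.sum_congr rfl fun i hi => by
          rw [Function.update_of_ne]
          rintro rfl
          exact ha hi
      rw [this, hfs, add_tsub_cancel_of_le (min_le_left _ _)]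

variable {n : ℕ}

/-- The half-open dyadic cube of side `2 ^ (-k)` with index `c`. -/
def dyadicCell (k : ℕ) (c : Fin n → ℤ) : Set (EuclideanSpace ℝ (Fin n)) :=
  {x | ∀ i, ⌊(2 : ℝ) ^ k * x i⌋ = c i}

theorem mem_dyadicCell_floor (k : ℕ) (x : EuclideanSpace ℝ (Fin n)) :
    x ∈ dyadicCell k (fun i => ⌊(2 : ℝ) ^ k * x i⌋) := fun _ => rfl

theorem dyadicCell_index_unique {k : ℕ} {c c' : Fin n → ℤ} {x : EuclideanSpace ℝ (Fin n)}
    (h : x ∈ dyadicCell k c) (h' : x ∈ dyadicCell k c') : c = c' :=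
  funext fun i => (h i).symm.trans (h' i)

theorem floor_two_pow_mul_eq_ediv {k l : ℕ} (hkl : k ≤ l) (a : ℝ) :
    ⌊(2 : ℝ) ^ k * a⌋ = ⌊(2 : ℝ) ^ l * a⌋ / (2 ^ (l - k) : ℕ) := by
  rw [← Int.floor_div_natCast]
  congr 1
  obtain ⟨d, rfl⟩ := Nat.exists_eq_add_of_le hkl
  push_cast
  rw [Nat.add_sub_cancel_left, pow_add]
  field_simp

theorem dyadicCell_subset_of_le {k l : ℕ} (hkl : k ≤ l) {c c' : Fin n → ℤ}
    {x : EuclideanSpace ℝ (Fin n)} (hx : x ∈ dyadicCell k c) (hx' : x ∈ dyadicCell l c') :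
    dyadicCell l c' ⊆ dyadicCell k c := by
  intro y hy i
  rw [floor_two_pow_mul_eq_ediv hkl, hy i, ← hx' i, ← floor_two_pow_mul_eq_ediv hkl, hx i]

theorem dyadicCell_subset_iUnion (k : ℕ) (c : Fin n → ℤ) :
    dyadicCell k c ⊆ ⋃ e : Fin n → Fin 2, dyadicCell (k + 1) (fun i => 2 * c i + (e i : ℕ)) := by
  intro x hx
  have h : ∀ i, ∃ e : Fin 2, ⌊(2 : ℝ) ^ (k + 1) * x i⌋ = 2 * c i + (e : ℕ) := by
    intro i
    have h1 := floor_two_pow_mul_eq_ediv (Nat.le_succ k) (x i)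
    rw [hx i] at h1
    simp only [Nat.succ_eq_add_one, add_tsub_cancel_left, pow_one, Nat.cast_ofNat] at h1
    rcases Int.emod_two_eq_zero_or_one ⌊(2 : ℝ) ^ (k + 1) * x i⌋ with h2 | h2
    · exact ⟨0, by simp; omega⟩
    · exact ⟨1, by simp; omega⟩
  choose e he using h
  exact Set.mem_iUnion.2 ⟨e, he⟩

theorem dyadicCell_child_subset (k : ℕ) (c : Fin n → ℤ) (e : Fin n → Fin 2) :
    dyadicCell (k + 1) (fun i => 2 * c i + (e i : ℕ)) ⊆ dyadicCell k c := by
  intro x hx i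
  rw [floor_two_pow_mul_eq_ediv (Nat.le_succ k), hx i]
  have := (e i).isLt
  simp
  omega

theorem dyadicCell_child_injective (c : Fin n → ℤ) :
    Function.Injective fun (e : Fin n → Fin 2) (i : Fin n) => 2 * c i + ((e i : ℕ) : ℤ) := by
  intro e e' h
  funext i
  have := congrFun h i
  simp only at this
  apply Fin.ext
  omega

/-- Mass distribution down a finite number of dyadic generations, dominated by an outer measure. -/
theorem exists_measure_dyadicCell_le (G : OuterMeasure (EuclideanSpace ℝ (Fin n))) {b : ℕ → ℝ≥0∞}
    (hb : ∀ k c, G (dyadicCell k c) ≤ b k) (A : Set (EuclideanSpace ℝ (Fin n))) (d : ℕ) :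
    ∀ (j : ℕ) (c : Fin n → ℤ) (m : ℝ≥0∞), m ≤ G (A ∩ dyadicCell j c) →
      ∃ μ : Measure (EuclideanSpace ℝ (Fin n)), μ (A ∩ dyadicCell j c)ᶜ = 0 ∧
        μ Set.univ = m ∧ ∀ l, j ≤ l → l ≤ j + d → ∀ c', μ (dyadicCell l c') ≤ b l := by
  have hbase : ∀ (μ : Measure (EuclideanSpace ℝ (Fin n))) (j : ℕ) (c : Fin n → ℤ) (m : ℝ≥0∞),
      m ≤ G (A ∩ dyadicCell j c) → μ (A ∩ dyadicCell j c)ᶜ = 0 → μ Set.univ = m →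
      ∀ c', μ (dyadicCell j c') ≤ b j := by
    intro μ j c m hm h0 hu c'
    rcases eq_or_ne c c' with rfl | hne
    · exact (measure_mono (Set.subset_univ _)).trans
        (hu.le.trans (hm.trans ((measure_mono Set.inter_subset_right).trans (hb j c))))
    · have : dyadicCell j c' ⊆ (A ∩ dyadicCell j c)ᶜ := fun x hx hx' =>
        hne (dyadicCell_index_unique hx'.2 hx)
      rw [measure_mono_null this h0]
      exact zero_le
  induction d with
  | zero =>
    intro j c m hm
    have hex : ∃ μ : Measure (EuclideanSpace ℝ (Fin n)), μ (A ∩ dyadicCell j c)ᶜ = 0 ∧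
        μ Set.univ = m := by
      rcases (A ∩ dyadicCell j c).eq_empty_or_nonempty with h | ⟨a, ha⟩
      · rw [h, measure_empty, nonpos_iff_eq_zero] at hm
        exact ⟨0, by simp, by simp [hm]⟩
      · refine ⟨m • Measure.dirac a, ?_, by simp⟩
        rw [Measure.smul_apply, Measure.dirac_apply]
        simp [ha.1, ha.2]
    obtain ⟨μ, h0, hu⟩ := hex
    refine ⟨μ, h0, hu, fun l h1 h2 c' => ?_⟩
    obtain rfl : l = j := by omega
    exact hbase μ l c m hm h0 hu c'
  | succ d ih =>
    intro j c m hm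
    have hsplit : m ≤ ∑ e : Fin n → Fin 2,
        G (A ∩ dyadicCell (j + 1) (fun i => 2 * c i + (e i : ℕ))) := by
      refine hm.trans ((measure_mono ?_).trans (measure_iUnion_fintype_le G _))
      rw [← Set.inter_iUnion]
      exact Set.inter_subset_inter_right _ (dyadicCell_subset_iUnion j c)
    obtain ⟨f, hf, hfs⟩ := exists_sum_eq_of_le_sum _ _ m hsplit
    choose μ h0 hu hμ using fun e => ih (j + 1) _ (f e) (hf e)
    have hnull : (∑ e, μ e) (A ∩ dyadicCell j c)ᶜ = 0 := by
      rw [Measure.finsetSum_apply]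
      refine Finset.sum_eq_zero fun e _ => measure_mono_null ?_ (h0 e)
      exact Set.compl_subset_compl.2
        (Set.inter_subset_inter_right _ (dyadicCell_child_subset j c e))
    have huniv : (∑ e, μ e) Set.univ = m := by
      rw [Measure.finsetSum_apply, ← hfs]
      exact Finset.sum_congr rfl fun e _ => hu e
    refine ⟨∑ e, μ e, hnull, huniv, fun l h1 h2 c' => ?_⟩
    rcases h1.eq_or_lt with rfl | h1
    · exact hbase _ _ c m hm hnull huniv c'
    · rw [Measure.finsetSum_apply]
      by_cases hex : ∃ e : Fin n → Fin 2,
          (dyadicCell l c' ∩ dyadicCell (j + 1) (fun i => 2 * c i + (e i : ℕ))).Nonempty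
      · obtain ⟨e, x, hx, hx'⟩ := hex
        rw [Finset.sum_eq_single_of_mem e (Finset.mem_univ _)]
        · exact hμ e l h1 (by omega) c'
        · intro e' _ hne
          have hsub : dyadicCell l c' ⊆
              (A ∩ dyadicCell (j + 1) (fun i => 2 * c i + (e' i : ℕ)))ᶜ := by
            refine fun y hy hy' => hne ?_
            exact dyadicCell_child_injective c (dyadicCell_index_unique hy'.2
              (dyadicCell_subset_of_le h1 hx' hx hy))
          exact measure_mono_null hsub (h0 e')
      · rw [Finset.sum_eq_zero]
        · exact zero_le
        · intro e _
          have hsub : dyadicCell l c' ⊆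
              (A ∩ dyadicCell (j + 1) (fun i => 2 * c i + (e i : ℕ)))ᶜ :=
            fun y hy hy' => hex ⟨e, y, hy, hy'.2⟩
          exact measure_mono_null hsub (h0 e)

theorem ediam_dyadicCell_le (k : ℕ) (c : Fin n → ℤ) :
    Metric.ediam (dyadicCell k c) ≤ ENNReal.ofReal (n * (2 ^ k)⁻¹) := by
  refine Metric.ediam_le fun x hx y hy => ?_
  rw [edist_dist]
  refine ENNReal.ofReal_le_ofReal ?_
  rw [EuclideanSpace.dist_eq]
  have h1 : ∀ i, dist (x i) (y i) ≤ (2 ^ k)⁻¹ := by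
    intro i
    have := Int.abs_sub_lt_one_of_floor_eq_floor ((hx i).trans (hy i).symm)
    rw [← mul_sub, abs_mul, abs_of_pos (by positivity)] at this
    rw [Real.dist_eq, ← one_div, le_div_iff₀' (by positivity)]
    exact this.le
  refine Real.sqrt_le_iff.2 ⟨by positivity, ?_⟩
  calc _ ≤ ∑ i : Fin n, ((2 : ℝ) ^ k)⁻¹ ^ 2 := by
        gcongr with i
        exact h1 i
    _ = n * ((2 : ℝ) ^ k)⁻¹ ^ 2 := by simp
    _ ≤ n ^ 2 * ((2 : ℝ) ^ k)⁻¹ ^ 2 := by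
        gcongr
        exact_mod_cast Nat.le_self_pow two_ne_zero n
    _ = _ := by ring

theorem ball_subset_iUnion_dyadicCell (x : EuclideanSpace ℝ (Fin n)) {r : ℝ} {l : ℕ}
    (hr : r ≤ (2 ^ l)⁻¹) :
    Metric.ball x r ⊆ ⋃ e : Fin n → Fin 3,
      dyadicCell l (fun i => ⌊(2 : ℝ) ^ l * x i⌋ - 1 + (e i : ℕ)) := by
  intro y hy
  have h : ∀ i, ∃ e : Fin 3, ⌊(2 : ℝ) ^ l * y i⌋ = ⌊(2 : ℝ) ^ l * x i⌋ - 1 + (e : ℕ) := by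
    intro i
    have h1 : |2 ^ l * y i - 2 ^ l * x i| < 1 := by
      rw [← mul_sub, abs_mul, abs_of_pos (by positivity), ← lt_div_iff₀' (by positivity), one_div]
      refine lt_of_le_of_lt ?_ ((Metric.mem_ball.1 hy).trans_le hr)
      rw [EuclideanSpace.dist_eq, ← Real.dist_eq]
      refine Real.le_sqrt_of_sq_le ?_
      exact Finset.single_le_sum (f := fun i => dist (y i) (x i) ^ 2)
        (fun _ _ => by positivity) (Finset.mem_univ i)
    obtain ⟨h2, h3⟩ := abs_lt.1 h1
    have a1 := Int.floor_le ((2 : ℝ) ^ l * y i)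
    have a2 := Int.lt_floor_add_one ((2 : ℝ) ^ l * y i)
    have a3 := Int.floor_le ((2 : ℝ) ^ l * x i)
    have a4 := Int.lt_floor_add_one ((2 : ℝ) ^ l * x i)
    generalize ⌊(2 : ℝ) ^ l * y i⌋ = u at *
    generalize ⌊(2 : ℝ) ^ l * x i⌋ = v at *
    have b1 : u < v + 2 := by
      have : (u : ℝ) < v + 2 := by linarith
      exact_mod_cast this
    have b2 : v < u + 2 := by
      have : (v : ℝ) < u + 2 := by linarith
      exact_mod_cast this
    refine ⟨⟨(u - v + 1).toNat, by omega⟩, ?_⟩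
    simp only
    omega
  choose e he using h
  exact Set.mem_iUnion.2 ⟨e, he⟩

/-- Frostman's lemma at a finite resolution. -/
theorem exists_frostman_measure {A : Set (EuclideanSpace ℝ (Fin n))} {s : ℝ} (hs : 0 < s)
    (hA : μH[s] A ≠ 0) :
    ∃ (m : ℝ≥0∞) (C : ℝ), m ≠ 0 ∧ m ≠ ⊤ ∧ 0 ≤ C ∧ ∀ ρ : ℝ, 0 < ρ →
      ∃ μ : Measure (EuclideanSpace ℝ (Fin n)), μ Aᶜ = 0 ∧ μ Set.univ = m ∧
        ∀ x r, ρ ≤ r → μ (Metric.ball x r) ≤ ENNReal.ofReal (C * r ^ s) := by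
  set G := OuterMeasure.boundedBy
    (fun S : Set (EuclideanSpace ℝ (Fin n)) => Metric.ediam S ^ s) with hG
  set b : ℕ → ℝ≥0∞ := fun k => ENNReal.ofReal ((n * (2 ^ k)⁻¹) ^ s) with hb
  have hGb : ∀ k c, G (dyadicCell (n := n) k c) ≤ b k := by
    intro k c
    refine (OuterMeasure.boundedBy_le _).trans ?_
    rw [hb]
    simp only
    rw [← ENNReal.ofReal_rpow_of_nonneg (by positivity) hs.le]
    exact ENNReal.rpow_le_rpow (ediam_dyadicCell_le k c) hs.le
  have hex : ∃ c : Fin n → ℤ, G (A ∩ dyadicCell 0 c) ≠ 0 := by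
    by_contra! h
    refine hA (measure_eq_zero_of_boundedBy_ediam_rpow_eq_zero hs ?_)
    refine measure_mono_null (fun x hx => ?_) (measure_iUnion_null h)
    exact Set.mem_iUnion.2 ⟨_, hx, mem_dyadicCell_floor 0 x⟩
  obtain ⟨c, hc⟩ := hex
  set m := G (A ∩ dyadicCell 0 c) with hm
  have hmb : m ≤ b 0 := (measure_mono Set.inter_subset_right).trans (hGb 0 c)
  have hmtop : m ≠ ⊤ := ne_top_of_le_ne_top ENNReal.ofReal_ne_top hmb
  refine ⟨m, m.toReal + 3 ^ n * (n * 2) ^ s, hc, hmtop, by positivity, fun ρ hρ => ?_⟩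
  obtain ⟨k, hk⟩ := exists_pow_lt_of_lt_one hρ (by norm_num : (1 / 2 : ℝ) < 1)
  obtain ⟨μ, h0, hu, hμ⟩ := exists_measure_dyadicCell_le G hGb A k 0 c m le_rfl
  refine ⟨μ, measure_mono_null (Set.compl_subset_compl.2 Set.inter_subset_left) h0, hu,
    fun x r hr => ?_⟩
  have hr0 : 0 < r := hρ.trans_le hr
  rcases le_or_gt 1 r with h1 | h1
  · refine (measure_mono (Set.subset_univ _)).trans (hu.le.trans ?_)
    refine (ENNReal.ofReal_toReal hmtop).symm.trans_le (ENNReal.ofReal_le_ofReal ?_)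
    have : 1 ≤ r ^ s := Real.one_le_rpow h1 hs.le
    have h2 : 0 ≤ (3 : ℝ) ^ n * (n * 2) ^ s := by positivity
    nlinarith [ENNReal.toReal_nonneg (a := m)]
  · obtain ⟨l, hl1, hl2⟩ := exists_nat_pow_near_of_lt_one hr0 h1.le (by norm_num : (0 : ℝ) < 1 / 2)
      (by norm_num)
    have hlk : l < k := by
      by_contra! h
      have := pow_le_pow_of_le_one (by norm_num : (0 : ℝ) ≤ 1 / 2) (by norm_num) h
      linarith
    have hl2' : r ≤ ((2 : ℝ) ^ l)⁻¹ := by simpa using hl2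
    calc μ (Metric.ball x r) ≤ μ (⋃ e : Fin n → Fin 3,
          dyadicCell l (fun i => ⌊(2 : ℝ) ^ l * x i⌋ - 1 + (e i : ℕ))) :=
          measure_mono (ball_subset_iUnion_dyadicCell x hl2')
      _ ≤ ∑ e : Fin n → Fin 3, μ (dyadicCell l (fun i => ⌊(2 : ℝ) ^ l * x i⌋ - 1 + (e i : ℕ))) :=
          measure_iUnion_fintype_le _ _
      _ ≤ ∑ e : Fin n → Fin 3, b l := Finset.sum_le_sum fun e _ => hμ l (zero_le) (by omega) _
      _ = ENNReal.ofReal (3 ^ n * (n * (2 ^ l)⁻¹) ^ s) := by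
          rw [ENNReal.ofReal_mul (by positivity)]
          simp [hb]
      _ ≤ _ := by
          refine ENNReal.ofReal_le_ofReal ?_
          have h3 : ((n : ℝ) * (2 ^ l)⁻¹) ^ s ≤ (n * 2) ^ s * r ^ s := by
            rw [← Real.mul_rpow (by positivity) hr0.le]
            refine Real.rpow_le_rpow (by positivity) ?_ hs.le
            rw [mul_assoc]
            gcongr
            rw [pow_succ] at hl1
            simp only [one_div, inv_pow] at hl1
            linarith
          have h4 : 0 ≤ m.toReal * r ^ s := by positivity
          have h5 : (0 : ℝ) < 3 ^ n := by positivity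
          nlinarith

end Frostman

/-- A weighted `L²` bound on the Fourier transform of a finite measure on the line bounds
the mass that its square gives to a neighbourhood of the diagonal. -/
lemma prod_abs_sub_le_of_fourier_bound (ν : Measure ℝ) [IsFiniteMeasure ν] {ε : ℝ} (hε : 0 < ε)
    {D p : ℝ} (hp : 1 < p)
    (h : ∀ z : ℝ, Real.exp (-(2 * ε ^ 2 * z ^ 2)) *
      ‖∫ y, Complex.exp (Complex.I * (z * y : ℝ)) ∂ν‖ ^ 2 ≤ D * (1 + ‖z‖) ^ (-p)) :
    ν.prod ν {q | |q.1 - q.2| ≤ 2 * ε} ≤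
      ENNReal.ofReal (2 * (D * ∫ z : ℝ, (1 + ‖z‖) ^ (-p))) * ENNReal.ofReal ε := by
  have hb : (0 : ℝ) < ε ^ 2 := by positivity
  have key := integral_gaussian_mul_norm_sq_fourier ν hb
  have hint : Integrable (fun z : ℝ => D * (1 + ‖z‖) ^ (-p)) :=
    (integrable_one_add_norm (by simpa using hp)).const_mul D
  have hle : ∫ z : ℝ, ‖∫ y, Complex.exp (-((ε ^ 2 : ℝ) : ℂ) * (‖z‖ : ℂ) ^ 2 +
      Complex.I * (inner ℝ y z : ℝ)) ∂ν‖ ^ 2 ≤ D * ∫ z : ℝ, (1 + ‖z‖) ^ (-p) := by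
    rw [← integral_const_mul]
    refine integral_mono_of_nonneg (Filter.Eventually.of_forall fun z => by positivity) hint
      (Filter.Eventually.of_forall fun z => ?_)
    refine le_trans (le_of_eq ?_) (h z)
    simp only
    simp_rw [Complex.exp_add]
    rw [integral_const_mul, norm_mul, mul_pow, Complex.norm_exp, ← Real.exp_nat_mul]
    congr 2
    · rw [← Complex.ofReal_pow, ← Complex.ofReal_neg, ← Complex.ofReal_mul, Complex.ofReal_re]
      simp only [Real.norm_eq_abs, sq_abs]
      push_cast
      ring
  set J := ∫ q, Real.exp (-(1 / (8 * ε ^ 2) * ‖q.1 - q.2‖ ^ 2)) ∂(ν.prod ν) with hJ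
  have hJ0 : 0 ≤ J := integral_nonneg fun q => by positivity
  have hJle : J ≤ ε * (D * ∫ z : ℝ, (1 + ‖z‖) ^ (-p)) := by
    have h1 : 1 / ε ≤ (Real.pi / (2 * ε ^ 2)) ^ ((Module.finrank ℝ ℝ : ℝ) / 2) := by
      rw [Module.finrank_self, Nat.cast_one, ← Real.sqrt_eq_rpow]
      apply Real.le_sqrt_of_sq_le
      rw [div_pow, one_pow, div_le_div_iff₀ (by positivity) (by positivity)]
      nlinarith [Real.two_le_pi]
    rw [key] at hle
    have := (mul_le_mul_of_nonneg_right h1 hJ0).trans hle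
    calc J = ε * (1 / ε * J) := by field_simp
      _ ≤ _ := by gcongr
  have hmeas : (ν.prod ν).real {q | |q.1 - q.2| ≤ 2 * ε} ≤ 2 * J := by
    have hi := integrable_exp_neg_mul_norm_sub_sq ν (b := 1 / (8 * ε ^ 2)) (by positivity)
    have hm := mul_meas_ge_le_integral_of_nonneg (μ := ν.prod ν)
      (f := fun q => Real.exp (-(1 / (8 * ε ^ 2) * ‖q.1 - q.2‖ ^ 2)))
      (Filter.Eventually.of_forall fun q => by positivity) hi (1 / 2)
    have hs : (ν.prod ν).real {q | |q.1 - q.2| ≤ 2 * ε} ≤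
        (ν.prod ν).real {q | 1 / 2 ≤ Real.exp (-(1 / (8 * ε ^ 2) * ‖q.1 - q.2‖ ^ 2))} := by
      refine measureReal_mono fun q hq => ?_
      have hq' : |q.1 - q.2| ≤ 2 * ε := hq
      have h2 : ‖q.1 - q.2‖ ^ 2 ≤ 4 * ε ^ 2 := by
        rw [Real.norm_eq_abs]
        nlinarith [abs_nonneg (q.1 - q.2)]
      have h3 : 1 / (8 * ε ^ 2) * ‖q.1 - q.2‖ ^ 2 ≤ 1 / 2 := by
        rw [one_div_mul_eq_div, div_le_iff₀ (by positivity)]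
        linarith
      have h4 := Real.add_one_le_exp (-(1 / (8 * ε ^ 2) * ‖q.1 - q.2‖ ^ 2))
      rw [Set.mem_ofPred_eq]
      linarith
    linarith
  rw [← ENNReal.ofReal_mul' hε.le, ← ofReal_measureReal]
  exact ENNReal.ofReal_le_ofReal (by linarith)

/-- Frequency-by-frequency estimate behind the `L²` bound. -/
lemma exp_neg_mul_sq_le_of_decay {p ε T z E M B : ℝ} (hp1 : 1 < p) (hp2 : p ≤ 2)
    (hε : 0 < ε) (hT : 2 ≤ T) (hεT : 1 ≤ ε ^ 2 * T) (hE : 0 ≤ E) (hB : 0 ≤ B) (hEM : E ≤ M)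
    (hdecay : 2 ≤ |z| → |z| ≤ T → E ^ 2 ≤ B * |z| ^ (-p)) :
    Real.exp (-(2 * ε ^ 2 * z ^ 2)) * E ^ 2 ≤ (9 * M ^ 2 + 4 * B) * (1 + ‖z‖) ^ (-p) := by
  have hM : 0 ≤ M := hE.trans hEM
  have hz := abs_nonneg z
  rw [Real.norm_eq_abs]
  have hexp1 : Real.exp (-(2 * ε ^ 2 * z ^ 2)) ≤ 1 := by
    rw [Real.exp_le_one_iff]; nlinarith [mul_nonneg (sq_nonneg ε) (sq_nonneg z)]
  have hEM2 : E ^ 2 ≤ M ^ 2 := by gcongr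
  have hpos : 0 < (1 + |z|) ^ (-p) := by positivity
  rcases lt_or_ge |z| 2 with h2 | h2
  · have h9 : 1 ≤ 9 * (1 + |z|) ^ (-p) := by
      rw [Real.rpow_neg (by positivity), ← div_eq_mul_inv, one_le_div (by positivity)]
      calc (1 + |z|) ^ p ≤ 3 ^ p := Real.rpow_le_rpow (by positivity) (by linarith) (by linarith)
        _ ≤ (3 : ℝ) ^ (2 : ℝ) := Real.rpow_le_rpow_of_exponent_le (by norm_num) hp2
        _ = 9 := by norm_num
    calc _ ≤ 1 * M ^ 2 := by gcongr
      _ ≤ M ^ 2 * (9 * (1 + |z|) ^ (-p)) := by nlinarith [sq_nonneg M]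
      _ ≤ _ := by nlinarith
  · have h4 : |z| ^ (-p) ≤ 4 * (1 + |z|) ^ (-p) := by
      have hz0 : 0 < |z| := by linarith
      rw [Real.rpow_neg (by positivity), Real.rpow_neg (by positivity), ← div_eq_mul_inv,
        inv_eq_one_div, div_le_div_iff₀ (by positivity) (by positivity), one_mul]
      calc (1 + |z|) ^ p ≤ (2 * |z|) ^ p :=
            Real.rpow_le_rpow (by positivity) (by linarith) (by linarith)
        _ = 2 ^ p * |z| ^ p := Real.mul_rpow (by norm_num) hz
        _ ≤ 2 ^ (2 : ℝ) * |z| ^ p := by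
            gcongr
            norm_num
        _ = _ := by norm_num
    rcases le_or_gt |z| T with hzT | hzT
    · calc _ ≤ 1 * (B * |z| ^ (-p)) := by
            have := hdecay h2 hzT
            gcongr
        _ ≤ 1 * (B * (4 * (1 + |z|) ^ (-p))) := by gcongr
        _ ≤ _ := by nlinarith [mul_nonneg (sq_nonneg M) hpos.le]
    · have hz1 : 1 ≤ ε ^ 2 * |z| := hεT.trans (by gcongr)
      have hw : |z| ≤ 2 * ε ^ 2 * z ^ 2 / 2 := by
        rw [← sq_abs z]; nlinarith
      have hez : Real.exp (-(2 * ε ^ 2 * z ^ 2)) ≤ |z| ^ (-p) := by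
        calc _ ≤ Real.exp (-(2 * |z|)) := Real.exp_le_exp.2 (by linarith)
          _ ≤ (|z| ^ 2)⁻¹ := by
            rw [Real.exp_neg]
            apply inv_anti₀ (by positivity)
            have := Real.add_one_le_exp |z|
            rw [two_mul, Real.exp_add]
            nlinarith
          _ = |z| ^ (-2 : ℝ) := by
            rw [Real.rpow_neg hz]; norm_num
          _ ≤ _ := Real.rpow_le_rpow_of_exponent_le (by linarith) (by linarith)
      calc _ ≤ (4 * (1 + |z|) ^ (-p)) * M ^ 2 := by
            have := hez.trans h4
            gcongr
        _ ≤ _ := by nlinarith [mul_nonneg (sq_nonneg M) hpos.le, mul_nonneg hB hpos.le]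

/-- Decay of the Fourier transform of the squared-distance measure of a measure satisfying
a Frostman condition at scales above `T⁻¹`. -/
lemma exists_norm_integral_cexp_norm_sub_sq_decay {V : Type*} [NormedAddCommGroup V]
    [InnerProductSpace ℝ V] [FiniteDimensional ℝ V] [MeasurableSpace V] [BorelSpace V]
    {s C R : ℝ} (hC : 0 ≤ C) : ∃ K, 0 ≤ K ∧ ∀ (μ : Measure V) [IsFiniteMeasure μ] (T : ℝ),
      (∀ᵐ x ∂μ, ‖x‖ ≤ R) →
      (∀ x r, 1 / T ≤ r → μ (Metric.ball x r) ≤ ENNReal.ofReal (C * r ^ s)) →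
      ∀ t, 2 ≤ t → t ≤ T →
        ‖∫ q, Complex.exp (Complex.I * t * (‖q.1 - q.2‖ : ℂ) ^ 2) ∂(μ.prod μ)‖ ≤
          K * μ.real Set.univ * t ^ ((Module.finrank ℝ V : ℝ) / 2 - s) := by
  obtain ⟨K, hK, h⟩ := exists_integral_gaussian_le_of_ball_bound (V := V) s
  refine ⟨Real.exp (4 * R ^ 2) * C * K * 2 ^ s, by positivity, fun μ _ T hR hball t ht htT => ?_⟩
  have ht0 : 0 < t := by linarith
  refine (norm_integral_cexp_norm_sub_sq_le μ hR ht).trans ?_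
  have h1 := h μ C (t / 2) hC (by positivity) fun x r hr => hball x r (le_trans ?_ hr)
  · rw [div_pow, show (2 : ℝ) ^ 2 = 4 by norm_num, Real.div_rpow ht0.le (by norm_num)] at h1
    calc _ ≤ Real.exp (4 * R ^ 2) * t ^ ((Module.finrank ℝ V : ℝ) / 2) *
          (μ.real Set.univ * (C * K * (t ^ s / 2 ^ s)⁻¹)) := by gcongr
      _ = _ := by
        rw [Real.rpow_sub ht0]
        field_simp
  · rw [inv_div]
    exact div_le_div₀ (by norm_num) (by norm_num) ht0 htT

/-- The squared-distance measure of a Frostman measure has a Fourier transform of weighted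
`L²` type. -/
lemma squared_distance_measure_bound {V : Type*} [NormedAddCommGroup V]
    [InnerProductSpace ℝ V] [FiniteDimensional ℝ V] [MeasurableSpace V] [BorelSpace V]
    {s C R M : ℝ} (hC : 0 ≤ C) (hs1 : (Module.finrank ℝ V : ℝ) + 1 < 2 * s)
    (hs2 : 2 * s ≤ Module.finrank ℝ V + 2) :
    ∃ L : ℝ, ∀ (μ : Measure V) [IsFiniteMeasure μ] (ε T : ℝ), 0 < ε → 2 ≤ T → 1 ≤ ε ^ 2 * T →
      μ.real Set.univ = M → (∀ᵐ x ∂μ, ‖x‖ ≤ R) →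
      (∀ x r, 1 / T ≤ r → μ (Metric.ball x r) ≤ ENNReal.ofReal (C * r ^ s)) →
      (((μ.prod μ).map (fun q => ‖q.1 - q.2‖ ^ 2)).prod
        ((μ.prod μ).map (fun q => ‖q.1 - q.2‖ ^ 2))) {q | |q.1 - q.2| ≤ 2 * ε} ≤
          ENNReal.ofReal L * ENNReal.ofReal ε := by
  obtain ⟨K, hK, h⟩ := exists_norm_integral_cexp_norm_sub_sq_decay (V := V) (s := s) (R := R) hC
  refine ⟨2 * ((9 * (M ^ 2) ^ 2 + 4 * (K * M) ^ 2) *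
    ∫ z : ℝ, (1 + ‖z‖) ^ (-(2 * s - Module.finrank ℝ V))), ?_⟩
  intro μ _ ε T hε hT hεT hM hR hball
  have hφ : Continuous (fun q : V × V => ‖q.1 - q.2‖ ^ 2) := by fun_prop
  refine prod_abs_sub_le_of_fourier_bound _ hε (by linarith) fun z => ?_
  rw [integral_map hφ.aemeasurable (Continuous.aestronglyMeasurable (by fun_prop))]
  refine exp_neg_mul_sq_le_of_decay (by linarith) (by linarith) hε hT hεT (norm_nonneg _)
    (by positivity) ?_ fun h2 hzT => ?_
  · refine (norm_integral_le_of_norm_le_const (C := 1)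
      (Filter.Eventually.of_forall fun q => ?_)).trans_eq ?_
    · rw [mul_comm, Complex.norm_exp_ofReal_mul_I]
    · rw [one_mul, ← Set.univ_prod_univ, measureReal_prod_prod, hM, sq]
  · have h0 : 0 < |z| := by linarith
    have hdec := h μ T hR hball |z| h2 hzT
    have heq : ‖∫ q, Complex.exp (Complex.I * ((z * ‖q.1 - q.2‖ ^ 2 : ℝ) : ℂ)) ∂(μ.prod μ)‖ =
        ‖∫ q, Complex.exp (Complex.I * (|z| : ℝ) * (‖q.1 - q.2‖ : ℂ) ^ 2) ∂(μ.prod μ)‖ := by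
      rcases abs_choice z with hz | hz
      · rw [hz]
        congr 2
        ext q
        push_cast
        ring_nf
      · rw [hz, ← Complex.norm_conj, ← integral_conj]
        congr 2
        ext q
        rw [← Complex.exp_conj]
        simp only [map_mul, Complex.conj_I, Complex.conj_ofReal]
        push_cast
        ring_nf
    rw [heq, neg_sub]
    refine (pow_le_pow_left₀ (norm_nonneg _) hdec 2).trans_eq ?_
    rw [hM, mul_pow, ← Real.rpow_natCast (|z| ^ _), ← Real.rpow_mul h0.le]
    congr 2
    push_cast
    ring

/-- Falconer: if `A ⊆ ℝⁿ`, `n ≥ 2`, is compact with `dim_H A > (n+1)/2`,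
then the distance set `Δ(A)` has positive Lebesgue measure. -/
theorem stmt_8 (n : ℕ) (hn : 2 ≤ n)
    (A : Set (EuclideanSpace ℝ (Fin n))) (hA : IsCompact A)
    (hdim : dimH A > ((n : ℝ≥0∞) + 1) / 2) :
    0 < volume {d : ℝ | ∃ x ∈ A, ∃ y ∈ A, dist x y = d} := by
  obtain ⟨s, hs1, hs2, hsA⟩ : ∃ s : NNReal, (n : ℝ) + 1 < 2 * s ∧ 2 * (s : ℝ) ≤ n + 2 ∧
      (s : ℝ≥0∞) < dimH A := by
    have h1 : ((n : ℝ≥0∞) + 1) / 2 < min (dimH A) (((n : ℝ≥0∞) + 2) / 2) := by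
      refine lt_min hdim (ENNReal.div_lt_div_right (by simp) (by simp) ?_)
      exact_mod_cast Nat.lt_succ_self (n + 1)
    obtain ⟨s, hs, hs'⟩ := ENNReal.lt_iff_exists_nnreal_btwn.1 h1
    refine ⟨s, ?_, ?_, hs'.trans_le (min_le_left _ _)⟩
    · rw [ENNReal.div_lt_iff (by simp) (by simp)] at hs
      have : ((n : NNReal) + 1) < s * 2 := by exact_mod_cast hs
      have : ((n : ℝ) + 1) < s * 2 := by exact_mod_cast this
      linarith
    · have hs'' := hs'.trans_le (min_le_right _ _)
      rw [ENNReal.lt_div_iff_mul_lt (by simp) (by simp)] at hs''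
      have : s * 2 < ((n : NNReal) + 2) := by exact_mod_cast hs''
      have : s * 2 < ((n : ℝ) + 2) := by exact_mod_cast this
      linarith
  have hs0 : (0 : ℝ) < s := by
    have : (0 : ℝ) ≤ n := n.cast_nonneg
    linarith
  obtain ⟨m, C, hm0, hm, hC, hfrost⟩ := exists_frostman_measure (A := A) hs0
    (by rw [hausdorffMeasure_of_lt_dimH hsA]; exact ENNReal.top_ne_zero)
  obtain ⟨R, hR⟩ := hA.isBounded.exists_norm_le
  obtain ⟨L, hL⟩ := squared_distance_measure_bound (V := EuclideanSpace ℝ (Fin n)) (s := s)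
    (C := C) (R := R) (M := m.toReal) hC (by simpa using hs1) (by simpa using hs2)
  have hφ : Continuous (fun q : EuclideanSpace ℝ (Fin n) × EuclideanSpace ℝ (Fin n) =>
    ‖q.1 - q.2‖ ^ 2) := by fun_prop
  have hK := (hA.prod hA).image hφ
  have hpos := volume_pos_of_forall_exists_measure hK (m := m * m) (C := ENNReal.ofReal L)
    (mul_ne_zero hm0 hm0) ENNReal.ofReal_ne_top fun ε hε => by
      obtain ⟨μ, hμA, hμu, hball⟩ := hfrost (1 / max 2 (1 / ε ^ 2)) (by positivity)
      have hfin : IsFiniteMeasure μ := ⟨by rw [hμu]; exact hm.lt_top⟩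
      have hae : ∀ᵐ x ∂μ, x ∈ A := mem_ae_iff.2 hμA
      refine ⟨(μ.prod μ).map (fun q => ‖q.1 - q.2‖ ^ 2), inferInstance, ?_, ?_,
        hL μ ε (max 2 (1 / ε ^ 2)) hε (le_max_left _ _) ?_ (by rw [measureReal_def, hμu])
          (hae.mono hR) hball⟩
      · rw [Measure.map_apply hφ.measurable hK.isClosed.measurableSet.compl]
        have hsub : (fun q : EuclideanSpace ℝ (Fin n) × EuclideanSpace ℝ (Fin n) =>
            ‖q.1 - q.2‖ ^ 2) ⁻¹' ((fun q => ‖q.1 - q.2‖ ^ 2) '' A ×ˢ A)ᶜ ⊆ (A ×ˢ A)ᶜ :=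
          fun q hq hqA => hq ⟨q, hqA, rfl⟩
        refine measure_mono_null hsub ?_
        rw [Measure.measure_prod_compl_eq_zero hμA hμA]
      · rw [Measure.map_apply hφ.measurable MeasurableSet.univ, Set.preimage_univ,
          ← Set.univ_prod_univ, Measure.prod_prod, hμu]
      · calc (1 : ℝ) = ε ^ 2 * (1 / ε ^ 2) := by field_simp
          _ ≤ _ := by gcongr; exact le_max_right _ _
  rw [pos_iff_ne_zero] at hpos ⊢
  refine fun h0 => hpos ?_
  refine measure_mono_null ?_ (addHaar_image_eq_zero_of_differentiableOn_of_addHaar_eq_zero volume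
    (f := fun d : ℝ => d ^ 2) (by fun_prop) h0)
  rintro _ ⟨⟨x, y⟩, ⟨hx, hy⟩, rfl⟩
  exact ⟨dist x y, ⟨x, hx, y, hy, rfl⟩, by simp [dist_eq_norm]⟩
end

section
/- Let n ≥ 2, let C ⊆ ℝ be a compact set with dim_H C > n/(2n−1), and let A = C × C × ⋯ × C ⊆ ℝ^n be the n-fold Cartesian product. Then there exists y ∈ A such that the pinned distance set Δ_y(A) = { |x − y| : x ∈ A } has positive one-dimensional Lebesgue measure; in particular the distance set Δ(A) = { |x − y| : x, y ∈ A } has positive one-dimensional Lebesgue measure. -/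
open MeasureTheory
open scoped ENNReal

section

open Set Filter Topology Metric
open scoped NNReal

/-- The `s`-dimensional Hausdorff content, as an outer measure on `ℝ`. -/
noncomputable def hausdorffContent (s : ℝ) (hs : 0 < s) : OuterMeasure ℝ :=
  OuterMeasure.ofFunction (fun S => ediam S ^ s) (by simp [hs])

theorem hausdorffContent_le {s : ℝ} (hs : 0 < s) (S : Set ℝ) :
    hausdorffContent s hs S ≤ ediam S ^ s :=
  OuterMeasure.ofFunction_le S

theorem hausdorffMeasure_eq_zero_of_hausdorffContent_eq_zero {s : ℝ} (hs : 0 < s) {S : Set ℝ}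
    (h : hausdorffContent s hs S = 0) : Measure.hausdorffMeasure s S = 0 := by
  rw [Measure.hausdorffMeasure_apply]
  simp only [ENNReal.iSup_eq_zero]
  intro r hr
  refine le_antisymm (le_of_forall_gt fun ε hε => ?_) bot_le
  have hpos : 0 < min ε (r ^ s) := lt_min hε (ENNReal.rpow_pos_of_nonneg hr hs.le)
  rw [hausdorffContent, OuterMeasure.ofFunction_apply] at h
  rw [← h] at hpos
  simp only [iInf_lt_iff] at hpos
  obtain ⟨t, ht, hlt⟩ := hpos
  refine lt_of_le_of_lt ?_ (hlt.trans_le (min_le_left _ _))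
  refine iInf_le_of_le t (iInf_le_of_le ht (iInf_le_of_le (fun n => ?_) ?_))
  · have h1 := (ENNReal.le_tsum (f := fun n => ediam (t n) ^ s) n).trans
      (hlt.le.trans (min_le_right _ _))
    exact (ENNReal.rpow_le_rpow_iff hs).1 h1
  · exact ENNReal.tsum_le_tsum fun n => iSup_le fun _ => le_rfl

/-- The Frostman condition of exponent `s` for a measure on the line. -/
def IsFrostman (μ : Measure ℝ) (s : ℝ) (K : ℝ≥0) : Prop :=
  ∀ a r : ℝ, 0 < r → μ (closedBall a r) ≤ K * ENNReal.ofReal (r ^ s)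

/-- **Frostman's lemma** on the line. The measure is the Stieltjes measure of the function
`x ↦ κ (C ∩ (-∞, x])`, where `κ` is the Hausdorff content. -/
theorem exists_isFrostman {C : Set ℝ} (hC : IsCompact C) {s : ℝ≥0} (hs : 0 < s)
    (hdim : (s : ℝ≥0∞) < dimH C) :
    ∃ (μ : Measure ℝ) (K : ℝ≥0), IsFiniteMeasure μ ∧ μ Cᶜ = 0 ∧ μ univ ≠ 0 ∧
      IsFrostman μ s K := by
  have hs' : (0 : ℝ) < s := hs
  set κ := hausdorffContent s hs' with hκ
  have hκC : κ C ≠ 0 := fun h => by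
    have := hausdorffMeasure_eq_zero_of_hausdorffContent_eq_zero hs' h
    rw [hausdorffMeasure_of_lt_dimH hdim] at this
    exact ENNReal.top_ne_zero this
  have hfinC : κ C ≠ ∞ := by
    refine ne_top_of_le_ne_top ?_ (hausdorffContent_le hs' C)
    exact ENNReal.rpow_ne_top_of_nonneg hs'.le hC.isBounded.ediam_ne_top
  have hfin : ∀ x, κ (C ∩ Iic x) ≠ ∞ := fun x =>
    ne_top_of_le_ne_top hfinC (measure_mono inter_subset_left)
  set F : ℝ → ℝ := fun x => (κ (C ∩ Iic x)).toReal with hF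
  have hmono : Monotone F := fun x y hxy =>
    ENNReal.toReal_mono (hfin y) (measure_mono (by gcongr))
  have hinc : ∀ x y, x ≤ y → F y - F x ≤ (y - x) ^ (s : ℝ) := by
    intro x y hxy
    have h1 : κ (C ∩ Iic y) ≤ κ (C ∩ Iic x) + κ (Icc x y) := by
      refine (measure_mono ?_).trans (measure_union_le _ _)
      intro z hz
      rcases le_total z x with h | h
      · exact Or.inl ⟨hz.1, h⟩
      · exact Or.inr ⟨h, hz.2⟩
    have h2 : κ (Icc x y) ≤ ENNReal.ofReal ((y - x) ^ (s : ℝ)) := by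
      refine (hausdorffContent_le hs' _).trans ?_
      rw [Real.ediam_Icc, ENNReal.ofReal_rpow_of_nonneg (by linarith) hs'.le]
    have h3 := ENNReal.toReal_mono (ENNReal.add_ne_top.2 ⟨hfin x, ENNReal.ofReal_ne_top⟩)
      (h1.trans (add_le_add_right h2 _))
    rw [ENNReal.toReal_add (hfin x) ENNReal.ofReal_ne_top, ENNReal.toReal_ofReal
      (Real.rpow_nonneg (by linarith) _)] at h3
    simp only [hF]
    linarith
  have hcont : ∀ x, ContinuousWithinAt F (Ici x) x := by
    intro x
    have hup : Tendsto (fun y => F x + (y - x) ^ (s : ℝ)) (𝓝[≥] x) (𝓝 (F x)) := by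
      have : ContinuousAt (fun y => F x + (y - x) ^ (s : ℝ)) x :=
        continuousAt_const.add ((continuousAt_id.sub continuousAt_const).rpow_const
          (Or.inr hs'.le))
      have h := this.tendsto.mono_left (nhdsWithin_le_nhds (s := Ici x))
      simpa [Real.zero_rpow hs'.ne'] using h
    refine tendsto_of_tendsto_of_tendsto_of_le_of_le' tendsto_const_nhds hup ?_ ?_
    · filter_upwards [self_mem_nhdsWithin] with y hy using hmono hy
    · filter_upwards [self_mem_nhdsWithin] with y hy
      linarith [hinc x y hy]
  set f : StieltjesFunction ℝ := ⟨F, hmono, hcont⟩ with hf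
  have hIoc : ∀ a b, f.measure (Ioc a b) = ENNReal.ofReal (F b - F a) := fun a b =>
    f.measure_Ioc a b
  refine ⟨f.measure, ⟨3 ^ (s : ℝ), by positivity⟩, ?_, ?_, ?_, ?_⟩
  · refine f.isFiniteMeasure_of_forall_abs_le (C := (κ C).toReal) fun x => ?_
    change |F x| ≤ _
    rw [abs_of_nonneg ENNReal.toReal_nonneg]
    exact ENNReal.toReal_mono hfinC (measure_mono inter_subset_left)
  · refine measure_null_of_locally_null _ fun x hx => ?_
    obtain ⟨ε, hε, hball⟩ := Metric.isOpen_iff.1 hC.isClosed.isOpen_compl x hx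
    refine ⟨Ioc (x - ε / 2) (x + ε / 2),
      mem_nhdsWithin_of_mem_nhds (Ioc_mem_nhds (by linarith) (by linarith)), ?_⟩
    rw [hIoc]
    have : C ∩ Iic (x + ε / 2) = C ∩ Iic (x - ε / 2) := by
      ext z
      simp only [mem_inter_iff, mem_Iic, and_congr_right_iff]
      intro hz
      refine ⟨fun h => ?_, fun h => by linarith⟩
      by_contra hlt
      refine hball (?_ : z ∈ ball x ε) hz
      rw [mem_ball, Real.dist_eq, abs_lt]
      constructor <;> linarith
    simp [hF, this]
  · obtain ⟨B, hB⟩ := hC.isBounded.subset_closedBall 0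
    intro h0
    have h1 : f.measure (Ioc (-B - 1) B) = 0 := measure_mono_null (subset_univ _) h0
    rw [hIoc] at h1
    have e1 : C ∩ Iic B = C := inter_eq_left.2 fun z hz => by
      have := hB hz
      rw [mem_closedBall, Real.dist_eq, abs_le] at this
      simp only [mem_Iic]; linarith
    have e2 : C ∩ Iic (-B - 1) = ∅ := by
      ext z
      simp only [mem_inter_iff, mem_Iic, mem_empty_iff_false, iff_false, not_and, not_le]
      intro hz
      have := hB hz
      rw [mem_closedBall, Real.dist_eq, abs_le] at this
      linarith
    simp only [hF, e1, e2, measure_empty, ENNReal.toReal_zero, sub_zero,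
      ENNReal.ofReal_toReal hfinC] at h1
    exact hκC h1
  · intro a r hr
    have hsub : closedBall a r ⊆ Ioc (a - 2 * r) (a + r) := by
      intro z hz
      rw [mem_closedBall, Real.dist_eq, abs_le] at hz
      constructor <;> linarith
    refine (measure_mono hsub).trans ?_
    rw [hIoc]
    refine (ENNReal.ofReal_le_ofReal (hinc _ _ (by linarith))).trans_eq ?_
    rw [show a + r - (a - 2 * r) = 3 * r by ring, Real.mul_rpow (by norm_num) hr.le,
      ENNReal.ofReal_mul (by positivity)]
    congr 1
    rw [ENNReal.ofReal_eq_coe_nnreal (by positivity)]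
    rfl

/-- The additive character `θ ↦ exp (-2πiθ)`. -/
noncomputable def wave (θ : ℝ) : ℂ := Complex.exp (((-2 * Real.pi * θ : ℝ) : ℂ) * Complex.I)

@[simp] theorem norm_wave (θ : ℝ) : ‖wave θ‖ = 1 := Complex.norm_exp_ofReal_mul_I _

theorem wave_add (a b : ℝ) : wave (a + b) = wave a * wave b := by
  rw [wave, wave, wave, ← Complex.exp_add]
  congr 1
  push_cast
  ring

theorem wave_zero : wave 0 = 1 := by simp [wave]

theorem wave_sum {ι : Type*} (S : Finset ι) (f : ι → ℝ) :
    wave (∑ i ∈ S, f i) = ∏ i ∈ S, wave (f i) := by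
  classical
  induction S using Finset.induction_on with
  | empty => simp [wave_zero]
  | insert a S ha ih => rw [Finset.sum_insert ha, Finset.prod_insert ha, wave_add, ih]

theorem conj_wave (a : ℝ) : (starRingEnd ℂ) (wave a) = wave (-a) := by
  rw [wave, wave, ← Complex.exp_conj]
  congr 1
  rw [map_mul, Complex.conj_ofReal, Complex.conj_I]
  push_cast
  ring

@[fun_prop] theorem continuous_wave : Continuous wave := by unfold wave; fun_prop

/-- The Gaussian `x ↦ exp (-π (R x)²)`. -/
noncomputable def gauss (R x : ℝ) : ℝ := Real.exp (-Real.pi * (R * x) ^ 2)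

theorem gauss_pos (R x : ℝ) : 0 < gauss R x := Real.exp_pos _

@[fun_prop] theorem continuous_gauss (R : ℝ) : Continuous (gauss R) := by unfold gauss; fun_prop

theorem integrable_gauss {R : ℝ} (hR : 0 < R) : Integrable (gauss R) := by
  have := integrable_exp_neg_mul_sq (b := Real.pi * R ^ 2) (by positivity)
  refine this.congr (Eventually.of_forall fun x => ?_)
  simp only [gauss]
  ring_nf

theorem integral_wave_mul_gauss {R : ℝ} (hR : 0 < R) (w : ℝ) :
    ∫ η, wave (η * w) * gauss R⁻¹ η = ((R * gauss R w : ℝ) : ℂ) := by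
  have hb : 0 < (((R ^ 2)⁻¹ : ℝ) : ℂ).re := by rw [Complex.ofReal_re]; positivity
  have h := congrFun (fourier_gaussian_pi hb) w
  rw [Real.fourier_real_eq_integral_exp_smul] at h
  have e1 : (((R ^ 2)⁻¹ : ℝ) : ℂ) ^ (1 / 2 : ℂ) = ((R⁻¹ : ℝ) : ℂ) := by
    have : (1 / 2 : ℂ) = ((1 / 2 : ℝ) : ℂ) := by push_cast; rfl
    rw [this, ← Complex.ofReal_cpow (by positivity), ← Real.sqrt_eq_rpow, ← inv_pow,
      Real.sqrt_sq (by positivity)]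
  rw [e1] at h
  have e2 : (1 / ((R⁻¹ : ℝ) : ℂ) * Complex.exp (-Real.pi / (((R ^ 2)⁻¹ : ℝ) : ℂ) * w ^ 2)) =
      ((R * gauss R w : ℝ) : ℂ) := by
    simp only [gauss]
    push_cast
    congr 1
    · simp
    · congr 1
      field_simp
  rw [e2] at h
  rw [← h]
  refine integral_congr_ae (Eventually.of_forall fun η => ?_)
  simp only [wave, gauss, smul_eq_mul]
  push_cast
  congr 1
  · congr 1; ring
  · congr 1; ring

theorem IsFrostman.lintegral_gauss_le {μ : Measure ℝ} {s : ℝ} {K : ℝ≥0} (h : IsFrostman μ s K)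
    (hs1 : s ≤ 1) :
    ∃ M : ℝ≥0∞, M ≠ ∞ ∧ ∀ R : ℝ, 0 < R → ∀ a : ℝ,
      ∫⁻ x, ENNReal.ofReal (gauss R (x - a)) ∂μ ≤ M * ENNReal.ofReal (R ^ (-s)) := by
  have hsum : Summable fun k : ℕ => Real.exp (-k) * ((k : ℝ) + 1) := by
    have h1 := Real.summable_pow_mul_exp_neg_nat_mul 1 (r := 1) one_pos
    have h0 := Real.summable_pow_mul_exp_neg_nat_mul 0 (r := 1) one_pos
    refine (h1.add h0).congr fun k => ?_
    simp
    ring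
  refine ⟨K * ∑' k : ℕ, ENNReal.ofReal (Real.exp (-k) * ((k : ℝ) + 1)),
    ENNReal.mul_ne_top ENNReal.coe_ne_top hsum.tsum_ofReal_ne_top, fun R hR a => ?_⟩
  have hpt : ∀ x, ENNReal.ofReal (gauss R (x - a)) ≤ ∑' k : ℕ,
      (closedBall a (((k : ℝ) + 1) / R)).indicator
        (fun _ => ENNReal.ofReal (Real.exp (-k))) x := by
    intro x
    set k := ⌊R * |x - a|⌋₊ with hk
    have hy : 0 ≤ R * |x - a| := by positivity
    have hk1 : (k : ℝ) ≤ R * |x - a| := Nat.floor_le hy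
    have hk2 : R * |x - a| < k + 1 := Nat.lt_floor_add_one _
    refine le_trans ?_ (ENNReal.le_tsum k)
    rw [indicator_of_mem]
    · refine ENNReal.ofReal_le_ofReal (Real.exp_le_exp.2 ?_)
      have e : (R * (x - a)) ^ 2 = (R * |x - a|) ^ 2 := by
        rw [mul_pow, mul_pow, sq_abs]
      have h3 : (k : ℝ) ≤ (k : ℝ) ^ 2 := by
        exact_mod_cast Nat.le_self_pow two_ne_zero k
      have h4 : (k : ℝ) ^ 2 ≤ (R * |x - a|) ^ 2 := by gcongr
      rw [e]
      nlinarith [Real.pi_gt_three, sq_nonneg (R * |x - a|)]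
    · rw [mem_closedBall, Real.dist_eq, le_div_iff₀ hR]
      linarith
  calc ∫⁻ x, ENNReal.ofReal (gauss R (x - a)) ∂μ
      ≤ ∫⁻ x, ∑' k : ℕ, (closedBall a (((k : ℝ) + 1) / R)).indicator
        (fun _ => ENNReal.ofReal (Real.exp (-k))) x ∂μ := lintegral_mono hpt
    _ = ∑' k : ℕ, ENNReal.ofReal (Real.exp (-k)) * μ (closedBall a (((k : ℝ) + 1) / R)) := by
      rw [lintegral_tsum fun k =>
        (measurable_const.indicator measurableSet_closedBall).aemeasurable]
      simp_rw [lintegral_indicator_const measurableSet_closedBall]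
    _ ≤ ∑' k : ℕ, (K * ENNReal.ofReal (Real.exp (-k) * ((k : ℝ) + 1))) *
          ENNReal.ofReal (R ^ (-s)) := by
      refine ENNReal.tsum_le_tsum fun k => ?_
      have hk : (0 : ℝ) < (k : ℝ) + 1 := by positivity
      refine (mul_le_mul_right (h a _ (div_pos hk hR)) _).trans ?_
      rw [Real.div_rpow hk.le hR.le, ENNReal.ofReal_mul (Real.exp_pos _).le, Real.rpow_neg hR.le,
        div_eq_mul_inv, ENNReal.ofReal_mul (by positivity)]
      have h1 : ((k : ℝ) + 1) ^ s ≤ (k : ℝ) + 1 := by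
        refine (Real.rpow_le_rpow_of_exponent_le ?_ hs1).trans_eq (Real.rpow_one _)
        have : (0 : ℝ) ≤ k := by positivity
        linarith
      have h2 := ENNReal.ofReal_le_ofReal h1
      calc ENNReal.ofReal (Real.exp (-k)) * (K * (ENNReal.ofReal (((k : ℝ) + 1) ^ s) *
            ENNReal.ofReal (R ^ s)⁻¹))
          ≤ ENNReal.ofReal (Real.exp (-k)) * (K * (ENNReal.ofReal ((k : ℝ) + 1) *
            ENNReal.ofReal (R ^ s)⁻¹)) := by gcongr
        _ = _ := by ring
    _ = _ := by rw [ENNReal.tsum_mul_right, ENNReal.tsum_mul_left]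

/-- The Fourier transform of the measure `g μ`. -/
noncomputable def ft (μ : Measure ℝ) (g : ℝ → ℂ) (ξ : ℝ) : ℂ := ∫ x, wave (x * ξ) * g x ∂μ

theorem stronglyMeasurable_ft (μ : Measure ℝ) [SFinite μ] {g : ℝ → ℂ} (hg : Measurable g) :
    StronglyMeasurable (ft μ g) := by
  refine StronglyMeasurable.integral_prod_right
    (f := fun ξ x => wave (x * ξ) * g x) (Measurable.stronglyMeasurable ?_)
  exact (continuous_wave.measurable.comp (by fun_prop)).mul (hg.comp measurable_snd)

theorem norm_ft_le (μ : Measure ℝ) [IsFiniteMeasure μ] {g : ℝ → ℂ} {B : ℝ}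
    (hgB : ∀ x, ‖g x‖ ≤ B) (ξ : ℝ) : ‖ft μ g ξ‖ ≤ B * μ.real univ :=
  norm_integral_le_of_norm_le_const (Eventually.of_forall fun x => by simpa using hgB x)

theorem norm_ft_sq_eq (μ : Measure ℝ) [SFinite μ] (g : ℝ → ℂ) (ξ : ℝ) :
    ((‖ft μ g ξ‖ ^ 2 : ℝ) : ℂ) =
      ∫ z : ℝ × ℝ, wave (ξ * (z.1 - z.2)) * (g z.1 * (starRingEnd ℂ) (g z.2)) ∂μ.prod μ := by
  have : ((‖ft μ g ξ‖ ^ 2 : ℝ) : ℂ) = ft μ g ξ * (starRingEnd ℂ) (ft μ g ξ) := by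
    rw [Complex.mul_conj, Complex.normSq_eq_norm_sq]
  rw [this, ft, ← integral_conj, ← integral_prod_mul]
  refine integral_congr_ae (Eventually.of_forall fun z => ?_)
  simp only [map_mul, conj_wave]
  rw [show ξ * (z.1 - z.2) = z.1 * ξ + -(z.2 * ξ) by ring, wave_add]
  ring

theorem IsFrostman.lintegral_ft_sq_mul_gauss_le {μ : Measure ℝ} [IsFiniteMeasure μ] {s : ℝ}
    {K : ℝ≥0} (h : IsFrostman μ s K) (hs1 : s ≤ 1) (B : ℝ) :
    ∃ M : ℝ≥0∞, M ≠ ∞ ∧ ∀ R : ℝ, 0 < R → ∀ g : ℝ → ℂ, Measurable g → (∀ x, ‖g x‖ ≤ B) →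
      ∫⁻ η, ENNReal.ofReal (‖ft μ g η‖ ^ 2) * ENNReal.ofReal (gauss R⁻¹ η) ≤
        M * ENNReal.ofReal (R ^ (1 - s)) := by
  obtain ⟨M, hM, hMb⟩ := h.lintegral_gauss_le hs1
  refine ⟨ENNReal.ofReal (B ^ 2) * M * μ univ, by finiteness, fun R hR g hg hgB => ?_⟩
  have hB : 0 ≤ B := (norm_nonneg _).trans (hgB 0)
  have hRi : 0 < R⁻¹ := inv_pos.2 hR
  have hint : Integrable fun η => ‖ft μ g η‖ ^ 2 * gauss R⁻¹ η := by
    refine (integrable_gauss hRi).bdd_mul (c := (B * μ.real univ) ^ 2)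
      ((stronglyMeasurable_ft μ hg).norm.pow 2).aestronglyMeasurable
      (Eventually.of_forall fun η => ?_)
    rw [norm_pow, norm_norm]
    gcongr
    exact norm_ft_le μ hgB η
  set c : ℝ × ℝ → ℂ := fun z => g z.1 * (starRingEnd ℂ) (g z.2) with hc
  have hcB : ∀ z, ‖c z‖ ≤ B ^ 2 := fun z => by
    simp only [hc, norm_mul, RCLike.norm_conj, sq]
    gcongr <;> apply hgB
  have hcm : Measurable c := by
    refine (hg.comp measurable_fst).mul ?_
    exact Complex.continuous_conj.measurable.comp (hg.comp measurable_snd)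
  have hswap : Integrable (Function.uncurry fun (η : ℝ) (z : ℝ × ℝ) =>
      wave (η * (z.1 - z.2)) * c z * (gauss R⁻¹ η : ℂ)) (volume.prod (μ.prod μ)) := by
    have h1 : Integrable (fun p : ℝ × (ℝ × ℝ) => ((gauss R⁻¹ p.1 : ℝ) : ℂ) * 1)
        (volume.prod (μ.prod μ)) :=
      Integrable.mul_prod (integrable_gauss hRi).ofReal (integrable_const (1 : ℂ))
    have h2 := h1.bdd_mul (c := B ^ 2)
      (f := fun p : ℝ × (ℝ × ℝ) => wave (p.1 * (p.2.1 - p.2.2)) * c p.2) ?_ ?_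
    · refine h2.congr (Eventually.of_forall fun p => ?_)
      simp [Function.uncurry]
    · refine Measurable.aestronglyMeasurable (Measurable.mul ?_ (hcm.comp measurable_snd))
      exact continuous_wave.measurable.comp (by fun_prop)
    · exact Eventually.of_forall fun p => by simpa using hcB p.2
  have hmain : ((∫ η, ‖ft μ g η‖ ^ 2 * gauss R⁻¹ η : ℝ) : ℂ) =
      ∫ z : ℝ × ℝ, c z * ((R * gauss R (z.1 - z.2) : ℝ) : ℂ) ∂μ.prod μ := by
    rw [← integral_complex_ofReal]
    have e1 : ∀ η, ((‖ft μ g η‖ ^ 2 * gauss R⁻¹ η : ℝ) : ℂ) =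
        ∫ z : ℝ × ℝ, wave (η * (z.1 - z.2)) * c z * (gauss R⁻¹ η : ℂ) ∂μ.prod μ := by
      intro η
      rw [integral_mul_const, Complex.ofReal_mul, norm_ft_sq_eq]
    simp_rw [e1]
    rw [integral_integral_swap hswap]
    refine integral_congr_ae (Eventually.of_forall fun z => ?_)
    simp only
    rw [← integral_wave_mul_gauss hR, ← integral_const_mul]
    refine integral_congr_ae (Eventually.of_forall fun η => ?_)
    simp only
    ring
  have hnn : 0 ≤ ∫ η, ‖ft μ g η‖ ^ 2 * gauss R⁻¹ η :=
    integral_nonneg fun η => mul_nonneg (by positivity) (gauss_pos _ _).le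
  calc ∫⁻ η, ENNReal.ofReal (‖ft μ g η‖ ^ 2) * ENNReal.ofReal (gauss R⁻¹ η)
      = ENNReal.ofReal (∫ η, ‖ft μ g η‖ ^ 2 * gauss R⁻¹ η) := by
        rw [ofReal_integral_eq_lintegral_ofReal hint
          (Eventually.of_forall fun η => mul_nonneg (by positivity) (gauss_pos _ _).le)]
        refine lintegral_congr fun η => ?_
        rw [ENNReal.ofReal_mul (by positivity)]
    _ = ‖((∫ η, ‖ft μ g η‖ ^ 2 * gauss R⁻¹ η : ℝ) : ℂ)‖ₑ := by
        rw [← ofReal_norm, Complex.norm_real, Real.norm_of_nonneg hnn]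
    _ ≤ ∫⁻ z : ℝ × ℝ, ENNReal.ofReal (B ^ 2 * R) * ENNReal.ofReal (gauss R (z.1 - z.2))
          ∂μ.prod μ := by
        rw [hmain]
        refine (enorm_integral_le_lintegral_enorm _).trans (lintegral_mono fun z => ?_)
        have hg0 := gauss_pos R (z.1 - z.2)
        rw [← ofReal_norm, ← ENNReal.ofReal_mul (by positivity), norm_mul, Complex.norm_real,
          Real.norm_of_nonneg (by positivity), mul_assoc]
        gcongr
        exact hcB z
    _ = ENNReal.ofReal (B ^ 2 * R) *
          ∫⁻ y, ∫⁻ x, ENNReal.ofReal (gauss R (x - y)) ∂μ ∂μ := by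
        rw [lintegral_const_mul _ (by fun_prop), lintegral_prod_symm _ (by fun_prop)]
    _ ≤ ENNReal.ofReal (B ^ 2 * R) * ∫⁻ _, M * ENNReal.ofReal (R ^ (-s)) ∂μ := by
        gcongr
        exact hMb R hR _
    _ = _ := by
        rw [lintegral_const, ENNReal.ofReal_mul (by positivity), sub_eq_add_neg,
          Real.rpow_add hR, Real.rpow_one, ENNReal.ofReal_mul hR.le]
        ring

theorem sq_lintegral_mul_le {α : Type*} [MeasurableSpace α] (μ : Measure α) {f g : α → ℝ≥0∞}
    (hf : Measurable f) (hg : Measurable g) :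
    (∫⁻ x, f x * g x ∂μ) ^ 2 ≤ (∫⁻ x, f x ^ 2 ∂μ) * ∫⁻ x, g x ^ 2 ∂μ := by
  have key := ENNReal.lintegral_mul_le_Lp_mul_Lq μ Real.HolderConjugate.two_two
    hf.aemeasurable hg.aemeasurable
  simp only [Pi.mul_apply, ENNReal.rpow_two] at key
  calc (∫⁻ x, f x * g x ∂μ) ^ 2 ≤ ((∫⁻ x, f x ^ 2 ∂μ) ^ (1 / 2 : ℝ) *
        (∫⁻ x, g x ^ 2 ∂μ) ^ (1 / 2 : ℝ)) ^ 2 := by gcongr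
    _ = _ := by
      rw [mul_pow, ← ENNReal.rpow_two, ← ENNReal.rpow_two, ← ENNReal.rpow_mul, ← ENNReal.rpow_mul]
      norm_num

theorem sq_lintegral_weight_mul_le {α : Type*} [MeasurableSpace α] (μ : Measure α)
    {w h : α → ℝ≥0∞} (hw : Measurable w) (hh : Measurable h) :
    (∫⁻ x, w x * h x ∂μ) ^ 2 ≤ (∫⁻ x, w x ∂μ) * ∫⁻ x, w x * h x ^ 2 ∂μ := by
  have e : ∀ x, (w x ^ (1 / 2 : ℝ)) ^ 2 = w x := fun x => by
    rw [← ENNReal.rpow_two, ← ENNReal.rpow_mul]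
    norm_num
  have key := sq_lintegral_mul_le μ (hw.pow_const (1 / 2 : ℝ))
    ((hw.pow_const (1 / 2 : ℝ)).mul hh)
  simpa only [Pi.mul_apply, ← mul_assoc, ← sq, mul_pow, e] using key

theorem gauss_one_eq_integral (x : ℝ) : (gauss 1 x : ℂ) = ∫ u, wave (u * x) * gauss 1 u := by
  have := integral_wave_mul_gauss one_pos x
  rw [inv_one, one_mul] at this
  exact this.symm

/-- The Fourier transform of `g μ` is locally averaged by a Gaussian when `g` has a Gaussian
factor. -/
theorem ft_mul_gauss (μ : Measure ℝ) [IsFiniteMeasure μ] {g : ℝ → ℂ} (hg : Measurable g) {B : ℝ}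
    (hgB : ∀ x, ‖g x‖ ≤ B) (η : ℝ) :
    ft μ (fun x => g x * gauss 1 x) η = ∫ v, (gauss 1 (v - η) : ℂ) * ft μ g v := by
  have hint : Integrable (Function.uncurry fun (x u : ℝ) =>
      wave (x * (u + η)) * g x * (gauss 1 u : ℂ)) (μ.prod volume) := by
    have h1 : Integrable (fun p : ℝ × ℝ => (1 : ℂ) * ((gauss 1 p.2 : ℝ) : ℂ))
        (μ.prod volume) :=
      Integrable.mul_prod (integrable_const (1 : ℂ)) (integrable_gauss one_pos).ofReal
    have h2 := h1.bdd_mul (c := B) (f := fun p : ℝ × ℝ => wave (p.1 * (p.2 + η)) * g p.1) ?_ ?_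
    · refine h2.congr (Eventually.of_forall fun p => ?_)
      simp [Function.uncurry]
    · refine Measurable.aestronglyMeasurable (Measurable.mul ?_ (hg.comp measurable_fst))
      exact continuous_wave.measurable.comp (by fun_prop)
    · exact Eventually.of_forall fun p => by simpa using hgB p.1
  have hshift : ∫ v, (gauss 1 (v - η) : ℂ) * ft μ g v =
      ∫ u, (gauss 1 u : ℂ) * ft μ g (u + η) := by
    rw [← integral_add_right_eq_self _ η]
    simp
  rw [hshift, ft]
  have e1 : ∀ u, (gauss 1 u : ℂ) * ft μ g (u + η) =
      ∫ x, wave (x * (u + η)) * g x * (gauss 1 u : ℂ) ∂μ := fun u => by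
    rw [integral_mul_const, ft, mul_comm]
  simp_rw [e1]
  rw [← integral_integral_swap hint]
  refine integral_congr_ae (Eventually.of_forall fun x => ?_)
  simp only
  rw [gauss_one_eq_integral, ← integral_const_mul, ← integral_const_mul]
  refine integral_congr_ae (Eventually.of_forall fun u => ?_)
  simp only
  rw [show x * (u + η) = u * x + x * η by ring, wave_add]
  ring

theorem ft_mul_gauss_sq_le (μ : Measure ℝ) [IsFiniteMeasure μ] {g : ℝ → ℂ} (hg : Measurable g)
    {B : ℝ} (hgB : ∀ x, ‖g x‖ ≤ B) (η : ℝ) :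
    ENNReal.ofReal (‖ft μ (fun x => g x * gauss 1 x) η‖ ^ 2) ≤
      ∫⁻ v, ENNReal.ofReal (gauss 1 (v - η)) * ENNReal.ofReal (‖ft μ g v‖ ^ 2) := by
  have hmeas : Measurable fun v => ENNReal.ofReal ‖ft μ g v‖ :=
    (stronglyMeasurable_ft μ hg).norm.measurable.ennreal_ofReal
  have htot : ∫⁻ v, ENNReal.ofReal (gauss 1 (v - η)) = 1 := by
    rw [lintegral_sub_right_eq_self (fun v => ENNReal.ofReal (gauss 1 v)) η,
      ← ofReal_integral_eq_lintegral_ofReal (integrable_gauss one_pos)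
        (Eventually.of_forall fun v => (gauss_pos 1 v).le)]
    have : ∫ v, gauss 1 v = 1 := by
      have h := gauss_one_eq_integral 0
      simp only [mul_zero, wave_zero, one_mul, integral_complex_ofReal] at h
      have h' := Complex.ofReal_injective h
      rw [← h']
      simp [gauss]
    rw [this, ENNReal.ofReal_one]
  rw [ENNReal.ofReal_pow (norm_nonneg _), ofReal_norm]
  calc ‖ft μ (fun x => g x * gauss 1 x) η‖ₑ ^ 2
      ≤ (∫⁻ v, ENNReal.ofReal (gauss 1 (v - η)) * ENNReal.ofReal ‖ft μ g v‖) ^ 2 := by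
        gcongr
        rw [ft_mul_gauss μ hg hgB]
        refine (enorm_integral_le_lintegral_enorm _).trans_eq (lintegral_congr fun v => ?_)
        rw [← ofReal_norm, norm_mul, Complex.norm_real, Real.norm_of_nonneg (gauss_pos _ _).le,
          ENNReal.ofReal_mul (gauss_pos _ _).le]
    _ ≤ _ := sq_lintegral_weight_mul_le volume (by fun_prop) hmeas
    _ = _ := by
        rw [htot, one_mul]
        simp_rw [ENNReal.ofReal_pow (norm_nonneg _)]

theorem gauss_sub_mul_le {lam L t η : ℝ} (hl : 1 ≤ |lam|) (ht : |t| ≤ L) :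
    gauss 1 (η - lam * t) ≤ Real.exp (Real.pi * L ^ 2) *
      (gauss (|lam| / 2) (t - η / lam) * gauss (2 * |lam|)⁻¹ η) := by
  have hl0 : lam ≠ 0 := fun h => by norm_num [h] at hl
  have hl2 : 1 ≤ lam ^ 2 := by rw [← sq_abs]; nlinarith
  have ht2 : t ^ 2 ≤ L ^ 2 := by rw [← sq_abs]; gcongr
  simp only [gauss, ← Real.exp_add]
  refine Real.exp_le_exp.2 ?_
  have e : η = lam * (η / lam) := by field_simp
  set z := η / lam with hz
  have e1 : (1 * (η - lam * t)) ^ 2 = lam ^ 2 * (z - t) ^ 2 := by rw [e]; ring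
  have e2 : (|lam| / 2 * (t - z)) ^ 2 = lam ^ 2 * (z - t) ^ 2 / 4 := by
    rw [mul_pow, div_pow, sq_abs]; ring
  have e3 : ((2 * |lam|)⁻¹ * η) ^ 2 = z ^ 2 / 4 := by
    rw [mul_pow, inv_pow, mul_pow, sq_abs, e]; field_simp; ring
  rw [e1, e2, e3]
  have h1 : (z - t) ^ 2 ≤ lam ^ 2 * (z - t) ^ 2 := by nlinarith [sq_nonneg (z - t)]
  have h2 : z ^ 2 / 4 ≤ L ^ 2 + 3 / 4 * (lam ^ 2 * (z - t) ^ 2) := by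
    nlinarith [sq_nonneg (z - 2 * t), sq_nonneg (z - 4 * t), sq_nonneg (z - 4 / 3 * t)]
  nlinarith [Real.pi_pos]

/-- Restriction estimate: the Fourier transform of `g μ`, sampled along the dilate of `μ` by
`lam`, has `L²` norm squared at most a constant times `lam ^ (1 - 2 s)`. -/
theorem IsFrostman.lintegral_ft_mul_sq_le {μ : Measure ℝ} [IsFiniteMeasure μ] {s : ℝ}
    {K : ℝ≥0} (h : IsFrostman μ s K) (hs1 : s ≤ 1) {L : ℝ} (hL : μ (closedBall 0 L)ᶜ = 0) :
    ∃ M : ℝ≥0∞, M ≠ ∞ ∧ ∀ lam : ℝ, 1 ≤ |lam| → ∀ g : ℝ → ℂ, Measurable g → (∀ x, ‖g x‖ ≤ 1) →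
      ∫⁻ t, ENNReal.ofReal (‖ft μ g (lam * t)‖ ^ 2) ∂μ ≤
        M * ENNReal.ofReal (|lam| ^ (1 - 2 * s)) := by
  set B : ℝ := Real.exp (Real.pi * L ^ 2) with hBdef
  obtain ⟨M₁, hM₁, hMb₁⟩ := h.lintegral_gauss_le hs1
  obtain ⟨M₂, hM₂, hMb₂⟩ := h.lintegral_ft_sq_mul_gauss_le hs1 B
  have hLae : ∀ᵐ t ∂μ, |t| ≤ L := by
    have : ∀ᵐ t ∂μ, t ∈ closedBall (0 : ℝ) L := hL
    filter_upwards [this] with t ht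
    simpa [mem_closedBall, Real.dist_eq] using ht
  refine ⟨ENNReal.ofReal B * M₁ * ENNReal.ofReal ((1 / 2) ^ (-s)) * M₂ *
    ENNReal.ofReal (2 ^ (1 - s)), by finiteness, fun lam hlam g hg hgB => ?_⟩
  have hl0 : 0 < |lam| := one_pos.trans_le hlam
  set G : ℝ → ℂ := (closedBall (0 : ℝ) L).indicator
    fun x => g x * Real.exp (Real.pi * x ^ 2) with hG
  have hGm : Measurable G :=
    (hg.mul (by fun_prop)).indicator measurableSet_closedBall
  have hGB : ∀ x, ‖G x‖ ≤ B := by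
    intro x
    by_cases hx : x ∈ closedBall (0 : ℝ) L
    · rw [hG, indicator_of_mem hx, norm_mul, Complex.norm_real, Real.norm_of_nonneg
        (Real.exp_pos _).le]
      rw [mem_closedBall, Real.dist_eq, sub_zero] at hx
      have hx2 : x ^ 2 ≤ L ^ 2 := by rw [← sq_abs]; gcongr
      calc ‖g x‖ * Real.exp (Real.pi * x ^ 2) ≤ 1 * Real.exp (Real.pi * L ^ 2) := by
            gcongr
            exact hgB x
        _ = B := one_mul _
    · rw [hG, indicator_of_notMem hx, norm_zero]
      positivity
  have hft : ∀ η, ft μ g η = ft μ (fun x => G x * gauss 1 x) η := by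
    intro η
    refine integral_congr_ae ?_
    filter_upwards [hLae] with x hx
    have hx' : x ∈ closedBall (0 : ℝ) L := by simpa [mem_closedBall, Real.dist_eq] using hx
    simp only [hG, indicator_of_mem hx', gauss, one_mul]
    rw [mul_assoc (g x), ← Complex.ofReal_mul, ← Real.exp_add]
    simp
  have hmeas : Measurable fun v => ENNReal.ofReal (‖ft μ G v‖ ^ 2) :=
    ((stronglyMeasurable_ft μ hGm).norm.measurable.pow_const 2).ennreal_ofReal
  calc ∫⁻ t, ENNReal.ofReal (‖ft μ g (lam * t)‖ ^ 2) ∂μ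
      ≤ ∫⁻ t, (∫⁻ v, ENNReal.ofReal (gauss 1 (v - lam * t)) *
          ENNReal.ofReal (‖ft μ G v‖ ^ 2)) ∂μ := by
        refine lintegral_mono fun t => ?_
        rw [hft]
        exact ft_mul_gauss_sq_le μ hGm hGB _
    _ = ∫⁻ v, ENNReal.ofReal (‖ft μ G v‖ ^ 2) *
          ∫⁻ t, ENNReal.ofReal (gauss 1 (v - lam * t)) ∂μ := by
        rw [lintegral_lintegral_swap]
        · refine lintegral_congr fun v => ?_
          rw [lintegral_mul_const _ (by fun_prop), mul_comm]
        · refine Measurable.aemeasurable (Measurable.mul ?_ (hmeas.comp measurable_snd))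
          exact Measurable.ennreal_ofReal (Continuous.measurable (by fun_prop))
    _ ≤ ∫⁻ v, ENNReal.ofReal (‖ft μ G v‖ ^ 2) * (ENNReal.ofReal (gauss (2 * |lam|)⁻¹ v) *
          (ENNReal.ofReal B * (M₁ * ENNReal.ofReal ((|lam| / 2) ^ (-s))))) := by
        gcongr with v
        calc ∫⁻ t, ENNReal.ofReal (gauss 1 (v - lam * t)) ∂μ
            ≤ ∫⁻ t, ENNReal.ofReal (gauss (2 * |lam|)⁻¹ v) * (ENNReal.ofReal B *
              ENNReal.ofReal (gauss (|lam| / 2) (t - v / lam))) ∂μ := by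
              refine lintegral_mono_ae ?_
              filter_upwards [hLae] with t ht
              rw [← ENNReal.ofReal_mul (Real.exp_pos _).le, ← ENNReal.ofReal_mul
                (gauss_pos _ _).le]
              refine ENNReal.ofReal_le_ofReal ((gauss_sub_mul_le hlam ht).trans_eq ?_)
              ring
          _ = ENNReal.ofReal (gauss (2 * |lam|)⁻¹ v) * (ENNReal.ofReal B *
              ∫⁻ t, ENNReal.ofReal (gauss (|lam| / 2) (t - v / lam)) ∂μ) := by
              rw [lintegral_const_mul _ (by fun_prop), lintegral_const_mul _ (by fun_prop)]
          _ ≤ _ := by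
              gcongr
              exact hMb₁ _ (by positivity) _
    _ = (∫⁻ v, ENNReal.ofReal (‖ft μ G v‖ ^ 2) * ENNReal.ofReal (gauss (2 * |lam|)⁻¹ v)) *
          (ENNReal.ofReal B * (M₁ * ENNReal.ofReal ((|lam| / 2) ^ (-s)))) := by
        rw [← lintegral_mul_const]
        · simp_rw [mul_assoc]
        · exact hmeas.mul (by fun_prop)
    _ ≤ (M₂ * ENNReal.ofReal ((2 * |lam|) ^ (1 - s))) *
          (ENNReal.ofReal B * (M₁ * ENNReal.ofReal ((|lam| / 2) ^ (-s)))) := by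
        gcongr
        exact hMb₂ _ (by positivity) G hGm hGB
    _ = _ := by
        rw [Real.mul_rpow (by norm_num) hl0.le, div_eq_mul_one_div,
          Real.mul_rpow hl0.le (by norm_num), ENNReal.ofReal_mul (by positivity),
          ENNReal.ofReal_mul (by positivity), show 1 - 2 * s = (1 - s) + (-s) by ring,
          Real.rpow_add hl0, ENNReal.ofReal_mul (by positivity)]
        ring

theorem IsFrostman.lintegral_ft_sq_mul_rpow_ne_top {ν : Measure ℝ} [IsFiniteMeasure ν] {s : ℝ}
    {K : ℝ≥0} (h : IsFrostman ν s K) (hs1 : s ≤ 1) {a : ℝ} (ha : 1 - s < a) :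
    ∫⁻ ξ, ENNReal.ofReal (‖ft ν (fun _ => 1) ξ‖ ^ 2) * ENNReal.ofReal ((1 + |ξ|) ^ (-a)) ≠ ∞ := by
  have ha0 : 0 ≤ a := by linarith
  obtain ⟨M, hM, hMb⟩ := h.lintegral_ft_sq_mul_gauss_le hs1 1
  set W := ENNReal.ofReal (Real.exp (4 * Real.pi)) with hW
  have hpt : ∀ ξ : ℝ, ENNReal.ofReal ((1 + |ξ|) ^ (-a)) ≤ ∑' k : ℕ,
      W * ENNReal.ofReal (((2 : ℝ) ^ k) ^ (-a)) * ENNReal.ofReal (gauss ((2 : ℝ) ^ k)⁻¹ ξ) := by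
    intro ξ
    have h1 : 1 ≤ 1 + |ξ| := by linarith [abs_nonneg ξ]
    obtain ⟨k, hk1, hk2⟩ := exists_nat_pow_near h1 (one_lt_two (α := ℝ))
    refine le_trans ?_ (ENNReal.le_tsum k)
    have h2 : (0 : ℝ) < 2 ^ k := by positivity
    rw [hW, ← ENNReal.ofReal_mul (Real.exp_pos _).le, ← ENNReal.ofReal_mul (by positivity)]
    refine ENNReal.ofReal_le_ofReal ?_
    have h3 : (1 + |ξ|) ^ (-a) ≤ ((2 : ℝ) ^ k) ^ (-a) :=
      Real.rpow_le_rpow_of_nonpos h2 hk1 (by linarith)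
    have h4 : 1 ≤ Real.exp (4 * Real.pi) * gauss ((2 : ℝ) ^ k)⁻¹ ξ := by
      rw [gauss, ← Real.exp_add, Real.one_le_exp_iff]
      have h5 : |((2 : ℝ) ^ k)⁻¹ * ξ| ≤ 2 := by
        rw [abs_mul, abs_inv, abs_of_pos h2, inv_mul_le_iff₀ h2]
        rw [pow_succ] at hk2
        linarith
      have h6 : (((2 : ℝ) ^ k)⁻¹ * ξ) ^ 2 ≤ 2 ^ 2 := by
        rw [← sq_abs]
        gcongr
      nlinarith [Real.pi_pos]
    calc (1 + |ξ|) ^ (-a) ≤ ((2 : ℝ) ^ k) ^ (-a) * 1 := by rwa [mul_one]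
      _ ≤ ((2 : ℝ) ^ k) ^ (-a) * (Real.exp (4 * Real.pi) * gauss ((2 : ℝ) ^ k)⁻¹ ξ) := by gcongr
      _ = _ := by ring
  have hmeas : Measurable fun v => ENNReal.ofReal (‖ft ν (fun _ => 1) v‖ ^ 2) :=
    ((stronglyMeasurable_ft ν measurable_const).norm.measurable.pow_const 2).ennreal_ofReal
  have hgeo : Summable fun k : ℕ => ((2 : ℝ) ^ (1 - s - a)) ^ k :=
    summable_geometric_of_lt_one (by positivity)
      (Real.rpow_lt_one_of_one_lt_of_neg one_lt_two (by linarith))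
  refine ne_top_of_le_ne_top
    (b := W * M * ∑' k : ℕ, ENNReal.ofReal (((2 : ℝ) ^ (1 - s - a)) ^ k)) ?_ ?_
  · exact ENNReal.mul_ne_top (by finiteness) hgeo.tsum_ofReal_ne_top
  calc ∫⁻ ξ, ENNReal.ofReal (‖ft ν (fun _ => 1) ξ‖ ^ 2) * ENNReal.ofReal ((1 + |ξ|) ^ (-a))
      ≤ ∫⁻ ξ, ∑' k : ℕ, W * ENNReal.ofReal (((2 : ℝ) ^ k) ^ (-a)) *
          (ENNReal.ofReal (‖ft ν (fun _ => 1) ξ‖ ^ 2) *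
            ENNReal.ofReal (gauss ((2 : ℝ) ^ k)⁻¹ ξ)) := by
        refine lintegral_mono fun ξ => ?_
        refine (mul_le_mul_right (hpt ξ) _).trans_eq ?_
        rw [← ENNReal.tsum_mul_left]
        exact tsum_congr fun k => by ring
    _ = ∑' k : ℕ, W * ENNReal.ofReal (((2 : ℝ) ^ k) ^ (-a)) *
          ∫⁻ ξ, (ENNReal.ofReal (‖ft ν (fun _ => 1) ξ‖ ^ 2) *
            ENNReal.ofReal (gauss ((2 : ℝ) ^ k)⁻¹ ξ)) := by
        have hm : ∀ k : ℕ, Measurable fun ξ => ENNReal.ofReal (‖ft ν (fun _ => 1) ξ‖ ^ 2) *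
            ENNReal.ofReal (gauss ((2 : ℝ) ^ k)⁻¹ ξ) := fun k => hmeas.mul (by fun_prop)
        rw [lintegral_tsum fun k => ((hm k).const_mul _).aemeasurable]
        exact tsum_congr fun k => lintegral_const_mul _ (hm k)
    _ ≤ ∑' k : ℕ, W * M * ENNReal.ofReal (((2 : ℝ) ^ (1 - s - a)) ^ k) := by
        refine ENNReal.tsum_le_tsum fun k => ?_
        refine (mul_le_mul_right (hMb _ (by positivity) _ measurable_const (by simp)) _).trans_eq ?_
        have : ((2 : ℝ) ^ (1 - s - a)) ^ k = ((2 : ℝ) ^ k) ^ (-a) * ((2 : ℝ) ^ k) ^ (1 - s) := by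
          rw [← Real.rpow_add (by positivity), ← Real.rpow_natCast, ← Real.rpow_natCast,
            ← Real.rpow_mul (by norm_num), ← Real.rpow_mul (by norm_num)]
          congr 1
          ring
        rw [this, ENNReal.ofReal_mul (by positivity)]
        ring
    _ = _ := ENNReal.tsum_mul_left

open scoped FourierTransform SchwartzMap Manifold in
/-- A compact set that carries a nonzero finite measure with square integrable Fourier transform
has positive Lebesgue measure. -/
theorem volume_pos_of_lintegral_ft_sq_ne_top {σ : Measure ℝ} [IsFiniteMeasure σ] {D : Set ℝ}
    (hD : IsCompact D) (hσD : σ Dᶜ = 0) (hσ : σ univ ≠ 0)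
    (hfin : ∫⁻ ξ, ENNReal.ofReal (‖ft σ (fun _ => 1) ξ‖ ^ 2) ≠ ⊤) : 0 < volume D := by
  by_contra hvol
  have hvol0 : volume D = 0 := by simpa using hvol
  set E := ∫⁻ ξ, ENNReal.ofReal (‖ft σ (fun _ => 1) ξ‖ ^ 2) with hE
  have hpos : 0 < σ univ ^ 2 / (E + 1) :=
    ENNReal.div_pos (pow_ne_zero 2 hσ) (by finiteness)
  rw [← hvol0] at hpos
  obtain ⟨U, hDU, hUo, hU⟩ := D.exists_isOpen_lt_of_lt _ hpos
  obtain ⟨r, hr⟩ := hD.isBounded.subset_ball 0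
  obtain ⟨f, hfs, hfr, hfsupp, hf1⟩ := exists_contMDiff_support_eq_eq_one_iff (n := ⊤) 𝓘(ℝ, ℝ)
    (hUo.inter isOpen_ball) hD.isClosed (subset_inter hDU hr)
  have hfs' : ContDiff ℝ ((⊤ : ℕ∞) : WithTop ℕ∞) fun x => (f x : ℂ) :=
    Complex.ofRealCLM.contDiff.comp hfs.contDiff
  have hfc : HasCompactSupport fun x => (f x : ℂ) := by
    refine HasCompactSupport.intro (isCompact_closedBall (0 : ℝ) r) fun x hx => ?_
    have : x ∉ Function.support f := by
      rw [hfsupp]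
      exact fun h => hx (ball_subset_closedBall h.2)
    simpa using this
  set φ : 𝓢(ℝ, ℂ) := hfc.toSchwartzMap hfs' with hφ
  have hφf : ∀ x, φ x = (f x : ℂ) := fun x => rfl
  have hinv : ∀ x, φ x = ∫ v, wave (x * -v) * 𝓕 φ v := by
    intro x
    have h1 : φ x = 𝓕⁻ (𝓕 φ) x := by rw [FourierTransform.fourierInv_fourier_eq]
    rw [h1, SchwartzMap.fourierInv_coe, Real.fourierInv_eq']
    refine integral_congr_ae (Eventually.of_forall fun v => ?_)
    simp only [wave, smul_eq_mul]
    congr 2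
    simp
  have hmass : σ univ = ‖∫ x, φ x ∂σ‖ₑ := by
    have hDae : ∀ᵐ x ∂σ, x ∈ D := hσD
    have : ∫ x, φ x ∂σ = ∫ _, (1 : ℂ) ∂σ := by
      refine integral_congr_ae ?_
      filter_upwards [hDae] with x hx
      rw [hφf, (hf1 x).1 hx, Complex.ofReal_one]
    rw [this, integral_const]
    simp [← ofReal_norm, abs_of_nonneg measureReal_nonneg]
  have hswap : ∫ x, φ x ∂σ = ∫ v, 𝓕 φ v * ft σ (fun _ => 1) (-v) := by
    simp_rw [hinv]
    rw [integral_integral_swap]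
    · refine integral_congr_ae (Eventually.of_forall fun v => ?_)
      simp only
      rw [integral_mul_const, ft, mul_comm]
      simp
    · have h1 : Integrable (fun p : ℝ × ℝ => (1 : ℂ) * 𝓕 φ p.2) (σ.prod volume) :=
        Integrable.mul_prod (integrable_const (1 : ℂ)) (𝓕 φ).integrable
      have h2 := h1.bdd_mul (c := 1) (f := fun p : ℝ × ℝ => wave (p.1 * -p.2))
        (Continuous.aestronglyMeasurable (by fun_prop))
        (Eventually.of_forall fun p => by simp)
      refine h2.congr (Eventually.of_forall fun p => ?_)
      simp [Function.uncurry]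
  have hmeas : Measurable fun v => ‖ft σ (fun _ => 1) v‖ₑ :=
    (stronglyMeasurable_ft σ measurable_const).measurable.enorm
  have hbound : σ univ ^ 2 ≤ (∫⁻ v, ‖𝓕 φ v‖ₑ ^ 2) * ∫⁻ v, ‖ft σ (fun _ => 1) (-v)‖ₑ ^ 2 := by
    refine le_trans ?_ (sq_lintegral_mul_le volume (𝓕 φ).continuous.measurable.enorm
      (hmeas.comp measurable_neg))
    rw [hmass, hswap]
    gcongr
    refine (enorm_integral_le_lintegral_enorm _).trans_eq (lintegral_congr fun v => ?_)
    simp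
  have hE' : ∫⁻ v, ‖ft σ (fun _ => 1) (-v)‖ₑ ^ 2 = E := by
    rw [lintegral_neg_eq_self (fun v => ‖ft σ (fun _ => 1) v‖ₑ ^ 2), hE]
    refine lintegral_congr fun v => ?_
    rw [ENNReal.ofReal_pow (norm_nonneg _), ofReal_norm]
  have hsq : ∀ ψ : 𝓢(ℝ, ℂ), ∫⁻ v, ‖ψ v‖ₑ ^ 2 = ENNReal.ofReal (∫ v, ‖ψ v‖ ^ 2) := by
    intro ψ
    have hi : Integrable fun v => ‖ψ v‖ ^ 2 := by
      simpa using (ψ.memLp 2 volume).integrable_norm_pow two_ne_zero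
    rw [ofReal_integral_eq_lintegral_ofReal hi
      (Eventually.of_forall fun v => by positivity)]
    refine lintegral_congr fun v => ?_
    rw [ENNReal.ofReal_pow (norm_nonneg _), ofReal_norm]
  have hP : ∫⁻ v, ‖𝓕 φ v‖ₑ ^ 2 ≤ volume U := by
    rw [hsq, SchwartzMap.integral_norm_sq_fourier, ← hsq, ← lintegral_indicator_one hUo.measurableSet]
    refine lintegral_mono fun x => ?_
    by_cases hx : x ∈ U
    · rw [indicator_of_mem hx, hφf, Pi.one_apply]
      refine pow_le_one₀ zero_le ?_
      have h01 := hfr (mem_range_self x)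
      rw [← ofReal_norm, Complex.norm_real, Real.norm_of_nonneg h01.1]
      exact ENNReal.ofReal_le_one.2 h01.2
    · have : x ∉ Function.support f := by
        rw [hfsupp]
        exact fun h => hx h.1
      have hx0 : f x = 0 := by simpa using this
      rw [hφf, hx0]
      simp
  rw [hE'] at hbound
  have hlt : volume U * (E + 1) < σ univ ^ 2 := by
    rwa [ENNReal.lt_div_iff_mul_lt (Or.inl (by simp)) (Or.inl (by finiteness))] at hU
  refine absurd hlt (not_lt.2 (hbound.trans ?_))
  gcongr
  exact le_self_add

theorem IsFrostman.mono {μ ν : Measure ℝ} {s : ℝ} {K : ℝ≥0} (h : IsFrostman μ s K)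
    (hνμ : ν ≤ μ) : IsFrostman ν s K := fun a r hr => (hνμ _).trans (h a r hr)

theorem IsFrostman.map_sub_sq {μ : Measure ℝ} {s : ℝ} {K : ℝ≥0} (h : IsFrostman μ s K)
    {y ε : ℝ} (hε : 0 < ε) (hμ : μ (Ici (y + ε))ᶜ = 0) :
    IsFrostman (μ.map fun x => (x - y) ^ 2) s (K * (ε⁻¹ ^ s).toNNReal) := by
  intro a r hr
  rw [Measure.map_apply (by fun_prop) measurableSet_closedBall]
  set S := (fun x => (x - y) ^ 2) ⁻¹' closedBall a r with hS
  have hle : μ S ≤ μ (S ∩ Ici (y + ε)) := by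
    refine (measure_le_inter_add_sdiff μ S (Ici (y + ε))).trans_eq ?_
    rw [measure_mono_null (show S \ Ici (y + ε) ⊆ (Ici (y + ε))ᶜ from fun x hx => hx.2) hμ,
      add_zero]
  refine hle.trans ?_
  rcases (S ∩ Ici (y + ε)).eq_empty_or_nonempty with h0 | ⟨x, hxS, hx⟩
  · simp [h0]
  have hsub : S ∩ Ici (y + ε) ⊆ closedBall x (r * ε⁻¹) := by
    rintro z ⟨hzS, hz⟩
    simp only [hS, mem_preimage, mem_closedBall, Real.dist_eq, mem_Ici] at hxS hzS hx hz ⊢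
    rw [← div_eq_mul_inv, le_div_iff₀ hε]
    have h1 : |z - x| * (z + x - 2 * y) ≤ 2 * r := by
      rw [← abs_of_nonneg (show 0 ≤ z + x - 2 * y by linarith), ← abs_mul]
      rw [abs_le] at *
      constructor <;> nlinarith
    nlinarith [abs_nonneg (z - x)]
  refine (measure_mono hsub).trans ((h x _ (by positivity)).trans_eq ?_)
  rw [Real.mul_rpow hr.le (by positivity), ENNReal.ofReal_mul (by positivity), ENNReal.coe_mul,
    ← ENNReal.ofReal]
  ring

/-- The Fourier transform of the image of `μ` under `x ↦ (x - t) ^ 2`. -/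
noncomputable def quadFt (μ : Measure ℝ) (t ξ : ℝ) : ℂ := ∫ x, wave ((x - t) ^ 2 * ξ) ∂μ

theorem measurable_quadFt (μ : Measure ℝ) [SFinite μ] :
    Measurable (Function.uncurry (quadFt μ)) :=
  (StronglyMeasurable.integral_prod_right
    (f := fun (p : ℝ × ℝ) x => wave ((x - p.1) ^ 2 * p.2))
    (Continuous.stronglyMeasurable (by fun_prop))).measurable

theorem norm_quadFt_le (μ : Measure ℝ) [IsFiniteMeasure μ] (t ξ : ℝ) :
    ‖quadFt μ t ξ‖ ≤ μ.real univ := by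
  simpa [quadFt] using norm_integral_le_of_norm_le_const (μ := μ) (C := 1)
    (f := fun x => wave ((x - t) ^ 2 * ξ)) (Eventually.of_forall fun x => by simp)

theorem ft_map_sub_sq (μ : Measure ℝ) (t ξ : ℝ) :
    ft (μ.map fun x => (x - t) ^ 2) (fun _ => 1) ξ = quadFt μ t ξ := by
  rw [ft, integral_map (by fun_prop) (Continuous.aestronglyMeasurable (by fun_prop))]
  simp [quadFt]

theorem norm_quadFt (μ : Measure ℝ) (t ξ : ℝ) :
    ‖quadFt μ t ξ‖ = ‖ft μ (fun x => wave (ξ * x ^ 2)) (-2 * ξ * t)‖ := by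
  have : quadFt μ t ξ = wave (ξ * t ^ 2) * ft μ (fun x => wave (ξ * x ^ 2)) (-2 * ξ * t) := by
    rw [quadFt, ft, ← integral_const_mul]
    refine integral_congr_ae (Eventually.of_forall fun x => ?_)
    simp only [← wave_add]
    ring_nf
  rw [this, norm_mul, norm_wave, one_mul]

theorem IsFrostman.lintegral_quadFt_sq_le {μ : Measure ℝ} [IsFiniteMeasure μ] {s : ℝ} {K : ℝ≥0}
    (h : IsFrostman μ s K) (hs : 1 / 2 ≤ s) (hs1 : s ≤ 1) {L : ℝ}
    (hL : μ (closedBall 0 L)ᶜ = 0) :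
    ∃ M : ℝ≥0∞, M ≠ ∞ ∧ ∀ ξ, ∫⁻ t, ENNReal.ofReal (‖quadFt μ t ξ‖ ^ 2) ∂μ ≤
      M * ENNReal.ofReal ((1 + |ξ|) ^ (1 - 2 * s)) := by
  obtain ⟨M, hM, hMb⟩ := h.lintegral_ft_mul_sq_le hs1 hL
  set B := ENNReal.ofReal (μ.real univ ^ 2) * μ univ with hB
  set W := ENNReal.ofReal (2 ^ (2 * s - 1)) with hW
  have hWB : W * ENNReal.ofReal ((2 : ℝ) ^ (1 - 2 * s)) = 1 := by
    rw [hW, ← ENNReal.ofReal_mul (by positivity), ← Real.rpow_add (by norm_num)]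
    simp
  refine ⟨(M + B) * W, by finiteness, fun ξ => ?_⟩
  have hξ := abs_nonneg ξ
  rcases le_or_gt 1 |-2 * ξ| with h1 | h1
  · simp_rw [norm_quadFt]
    refine (hMb _ h1 _ (by fun_prop) (by simp)).trans ?_
    rw [mul_assoc]
    refine mul_le_mul' le_self_add ?_
    rw [hW, ← ENNReal.ofReal_mul (by positivity)]
    refine ENNReal.ofReal_le_ofReal ?_
    rw [abs_mul, abs_neg, abs_two] at *
    calc (2 * |ξ|) ^ (1 - 2 * s) ≤ (2⁻¹ * (1 + |ξ|)) ^ (1 - 2 * s) :=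
          Real.rpow_le_rpow_of_nonpos (by positivity) (by linarith) (by linarith)
      _ = _ := by
          rw [Real.mul_rpow (by norm_num) (by positivity), Real.inv_rpow (by norm_num),
            ← Real.rpow_neg (by norm_num), neg_sub]
  · calc ∫⁻ t, ENNReal.ofReal (‖quadFt μ t ξ‖ ^ 2) ∂μ
        ≤ ∫⁻ _, ENNReal.ofReal (μ.real univ ^ 2) ∂μ := by
          refine lintegral_mono fun t => ENNReal.ofReal_le_ofReal ?_
          gcongr
          exact norm_quadFt_le μ t ξ
      _ = B * (W * ENNReal.ofReal ((2 : ℝ) ^ (1 - 2 * s))) := by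
          rw [lintegral_const, hWB, mul_one]
      _ ≤ (M + B) * (W * ENNReal.ofReal ((1 + |ξ|) ^ (1 - 2 * s))) := by
          refine mul_le_mul' le_add_self (mul_le_mul_right (ENNReal.ofReal_le_ofReal ?_) _)
          rw [abs_mul, abs_neg, abs_two] at h1
          exact Real.rpow_le_rpow_of_nonpos (by positivity) (by linarith) (by linarith)
      _ = _ := by ring

theorem ft_map_sum_sub_sq {ι : Type*} [Fintype ι] (m : ι → Measure ℝ) [∀ i, SigmaFinite (m i)]
    (t : ι → ℝ) (ξ : ℝ) :
    ft ((Measure.pi m).map fun x => ∑ i, (x i - t i) ^ 2) (fun _ => 1) ξ =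
      ∏ i, quadFt (m i) (t i) ξ := by
  rw [ft, integral_map (Continuous.measurable (by fun_prop)).aemeasurable
    (Continuous.aestronglyMeasurable (by fun_prop))]
  simp_rw [mul_one, Finset.sum_mul, wave_sum]
  exact integral_fintype_prod_eq_prod (fun i x => wave ((x - t i) ^ 2 * ξ))

theorem lintegral_ofReal_prod_pi {ι : Type*} [Fintype ι] (ρ : ι → Measure ℝ)
    [∀ i, IsFiniteMeasure (ρ i)] {f : ι → ℝ → ℝ} (hf : ∀ i, Integrable (f i) (ρ i))
    (hf0 : ∀ i x, 0 ≤ f i x) :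
    ∫⁻ t, ENNReal.ofReal (∏ i, f i (t i)) ∂Measure.pi ρ =
      ∏ i, ∫⁻ x, ENNReal.ofReal (f i x) ∂ρ i := by
  rw [← ofReal_integral_eq_lintegral_ofReal (Integrable.fintype_prod hf)
    (Eventually.of_forall fun t => Finset.prod_nonneg fun i _ => hf0 i _),
    integral_fintype_prod_eq_prod, ENNReal.ofReal_prod_of_nonneg
      fun i _ => integral_nonneg (hf0 i)]
  exact Finset.prod_congr rfl fun i _ =>
    ofReal_integral_eq_lintegral_ofReal (hf i) (Eventually.of_forall (hf0 i))

theorem ae_lintegral_ft_map_sum_sub_sq_ne_top {ι : Type*} [Fintype ι] (m ρ : ι → Measure ℝ)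
    [∀ i, IsFiniteMeasure (m i)] [∀ i, IsFiniteMeasure (ρ i)]
    (hfin : ∫⁻ ξ, ∏ i, ∫⁻ t, ENNReal.ofReal (‖quadFt (m i) t ξ‖ ^ 2) ∂ρ i ≠ ∞) :
    ∀ᵐ t ∂Measure.pi ρ, ∫⁻ ξ, ENNReal.ofReal
      (‖ft ((Measure.pi m).map fun x => ∑ i, (x i - t i) ^ 2) (fun _ => 1) ξ‖ ^ 2) ≠ ∞ := by
  simp_rw [ft_map_sum_sub_sq, norm_prod, ← Finset.prod_pow]
  have hint : ∀ i ξ, Integrable (fun t => ‖quadFt (m i) t ξ‖ ^ 2) (ρ i) := by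
    intro i ξ
    refine Integrable.of_bound (C := (m i).real univ ^ 2) ?_ (Eventually.of_forall fun t => ?_)
    · exact (((measurable_quadFt (m i)).comp
        (measurable_id.prodMk measurable_const)).norm.pow_const 2).aestronglyMeasurable
    · rw [norm_pow, norm_norm]
      gcongr
      exact norm_quadFt_le _ _ _
  have hmeas : Measurable fun p : (ι → ℝ) × ℝ =>
      ENNReal.ofReal (∏ i, ‖quadFt (m i) (p.1 i) p.2‖ ^ 2) := by
    refine (Finset.measurable_prod _ fun i _ => ?_).ennreal_ofReal
    exact ((measurable_quadFt (m i)).comp (f := fun p : (ι → ℝ) × ℝ => (p.1 i, p.2))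
      (by fun_prop)).norm.pow_const 2
  refine (ae_lt_top (Measurable.lintegral_prod_right hmeas) ?_).mono fun t ht => ht.ne
  rw [lintegral_lintegral_swap hmeas.aemeasurable]
  exact ne_of_eq_of_ne (lintegral_congr fun ξ => lintegral_ofReal_prod_pi ρ
    (f := fun i x => ‖quadFt (m i) x ξ‖ ^ 2) (hint · ξ) fun i x => by positivity) hfin

theorem IsFrostman.exists_lt_measure_compl_closedBall {μ : Measure ℝ} [IsFiniteMeasure μ] {s : ℝ}
    {K : ℝ≥0} (h : IsFrostman μ s K) (hs : 0 < s) (hμ : μ univ ≠ 0) (y : ℝ) :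
    ∃ ε : ℝ, 0 < ε ∧ μ (closedBall y ε)ᶜ ≠ 0 := by
  have hm : 0 < μ.real univ := ENNReal.toReal_pos hμ (measure_ne_top _ _)
  have hK : (0 : ℝ) ≤ K := K.2
  have hε : 0 < (μ.real univ / (K + 1)) ^ s⁻¹ := by positivity
  set ε := (μ.real univ / (K + 1)) ^ s⁻¹ with hε_def
  refine ⟨ε, hε, fun h0 => ?_⟩
  have h1 := h y ε hε
  rw [hε_def, ← Real.rpow_mul (by positivity), inv_mul_cancel₀ hs.ne', Real.rpow_one,
    ← hε_def] at h1
  have h2 : μ univ ≤ μ (closedBall y ε) :=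
    (measure_univ_le_add_compl (closedBall y ε)).trans_eq (by rw [h0, add_zero])
  have h3 := h2.trans h1
  rw [← ofReal_measureReal, ← ENNReal.ofReal_coe_nnreal, ← ENNReal.ofReal_mul hK,
    ENNReal.ofReal_le_ofReal_iff (by positivity), mul_div_assoc', le_div_iff₀ (by positivity)] at h3
  nlinarith

theorem exists_volume_image_sum_sub_sq_pos {ι : Type*} [Fintype ι] [Nonempty ι] {C : Set ℝ}
    (hC : IsCompact C) {s : ℝ≥0} (hs : 1 / 2 ≤ s) (hdim : (s : ℝ≥0∞) < dimH C)
    (hsn : (Fintype.card ι : ℝ) < s * (2 * Fintype.card ι - 1)) :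
    ∃ t : ι → ℝ, (∀ i, t i ∈ C) ∧
      0 < volume ((fun x : ι → ℝ => ∑ i, (x i - t i) ^ 2) '' univ.pi fun _ => C) := by
  classical
  have hs0 : 0 < s := lt_of_lt_of_le (by norm_num) hs
  have hsR : (1 / 2 : ℝ) ≤ s := by exact_mod_cast hs
  have hs1 : (s : ℝ) ≤ 1 := by
    have h1 : (s : ℝ≥0∞) < 1 := hdim.trans_le ((dimH_mono (subset_univ C)).trans_eq Real.dimH_univ)
    exact_mod_cast h1.le
  obtain ⟨μ, K, hμfin, hμC, hμ0, hμ⟩ := exists_isFrostman hC hs0 hdim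
  have hCne : C.Nonempty := by
    by_contra h0
    rw [not_nonempty_iff_eq_empty.1 h0, compl_empty] at hμC
    exact hμ0 hμC
  obtain ⟨y, hyC, hy⟩ := hC.exists_isLeast hCne
  obtain ⟨ε, hε, hμε⟩ := hμ.exists_lt_measure_compl_closedBall (by exact_mod_cast hs0) hμ0 y
  obtain ⟨L, hL⟩ := hC.isBounded.subset_closedBall 0
  have hμL : μ (closedBall 0 L)ᶜ = 0 := measure_mono_null (compl_subset_compl.2 hL) hμC
  set μ₀ := μ.restrict (Ici (y + ε)) with hμ₀
  have hμ₀0 : μ₀ univ ≠ 0 := by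
    rw [hμ₀, Measure.restrict_apply_univ]
    refine fun h0 => hμε (measure_mono_null (t := Ici (y + ε) ∪ Cᶜ) (fun x hx => ?_)
      (measure_union_null h0 hμC))
    by_cases hxC : x ∈ C
    · left
      have := hy hxC
      rw [mem_compl_iff, mem_closedBall, Real.dist_eq, abs_of_nonneg (by linarith)] at hx
      simp only [mem_Ici]
      linarith
    · exact Or.inr hxC
  have hμ₀C : μ₀ Cᶜ = 0 := Measure.absolutelyContinuous_of_le Measure.restrict_le_self hμC
  have hν := (hμ.mono Measure.restrict_le_self).map_sub_sq (μ := μ₀) hε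
    (by rw [hμ₀, Measure.restrict_apply measurableSet_Ici.compl, compl_inter_self, measure_empty])
  obtain ⟨M, hM, hMb⟩ := hμ.lintegral_quadFt_sq_le hsR hs1 hμL
  obtain ⟨j⟩ := ‹Nonempty ι›
  set m : ι → Measure ℝ := Function.update (fun _ => μ) j μ₀ with hm
  set ρ : ι → Measure ℝ := Function.update (fun _ => μ) j (Measure.dirac y) with hρ
  have hmj : m j = μ₀ := Function.update_self ..
  have hρj : ρ j = Measure.dirac y := Function.update_self ..
  have hmi : ∀ i ≠ j, m i = μ := fun i hi => Function.update_of_ne hi ..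
  have hρi : ∀ i ≠ j, ρ i = μ := fun i hi => Function.update_of_ne hi ..
  have key : ∀ i, IsFiniteMeasure (m i) ∧ IsFiniteMeasure (ρ i) ∧ m i Cᶜ = 0 ∧ ρ i Cᶜ = 0 ∧
      m i univ ≠ 0 ∧ ρ i univ ≠ 0 := by
    intro i
    rcases eq_or_ne i j with rfl | hi
    · rw [hmj, hρj]
      refine ⟨inferInstance, inferInstance, hμ₀C, ?_, hμ₀0, by simp⟩
      rw [Measure.dirac_apply' _ hC.measurableSet.compl]
      simp [hyC]
    · rw [hmi i hi, hρi i hi]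
      exact ⟨hμfin, hμfin, hμC, hμC, hμ0, hμ0⟩
  have := fun i => (key i).1
  have := fun i => (key i).2.1
  have hfin : ∫⁻ ξ, ∏ i, ∫⁻ t, ENNReal.ofReal (‖quadFt (m i) t ξ‖ ^ 2) ∂ρ i ≠ ∞ := by
    have hsmul := hν.lintegral_ft_sq_mul_rpow_ne_top hs1
      (a := (2 * s - 1) * (Fintype.card ι - 1 : ℕ)) (by
        rw [Nat.cast_sub (Fintype.card_pos_iff.2 ⟨j⟩)]
        push_cast
        linarith)
    refine ne_top_of_le_ne_top (ENNReal.mul_ne_top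
      (ENNReal.pow_ne_top hM (n := Fintype.card ι - 1)) hsmul) ?_
    rw [← lintegral_const_mul' _ _ (ENNReal.pow_ne_top hM)]
    refine lintegral_mono fun ξ => ?_
    rw [← Finset.mul_prod_erase _ _ (Finset.mem_univ j), hmj, hρj, lintegral_dirac,
      ← ft_map_sub_sq, mul_left_comm]
    refine mul_le_mul_right ?_ _
    calc ∏ i ∈ Finset.univ.erase j, ∫⁻ t, ENNReal.ofReal (‖quadFt (m i) t ξ‖ ^ 2) ∂ρ i
        ≤ ∏ i ∈ Finset.univ.erase j, M * ENNReal.ofReal ((1 + |ξ|) ^ (1 - 2 * (s : ℝ))) := by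
          refine Finset.prod_le_prod' fun i hi => ?_
          rw [hmi i (Finset.ne_of_mem_erase hi), hρi i (Finset.ne_of_mem_erase hi)]
          exact hMb ξ
      _ = _ := by
          rw [Finset.prod_const, Finset.card_erase_of_mem (Finset.mem_univ j), Finset.card_univ,
            mul_pow, ← ENNReal.ofReal_pow (by positivity), ← Real.rpow_natCast,
            ← Real.rpow_mul (by positivity), ← neg_mul, neg_sub]
  have hQ : Measure.pi ρ univ ≠ 0 := by
    rw [Measure.pi_univ]
    exact Finset.prod_ne_zero_iff.2 fun i _ => (key i).2.2.2.2.2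
  have : NeZero (Measure.pi ρ) := ⟨fun h0 => hQ (by simp [h0])⟩
  have hmem : ∀ᵐ t ∂Measure.pi ρ, ∀ i, t i ∈ C := eventually_all.2 fun i =>
    Measure.tendsto_eval_ae_ae.eventually (show ∀ᵐ x ∂ρ i, x ∈ C from (key i).2.2.2.1)
  obtain ⟨t, ht, htC⟩ := ((ae_lintegral_ft_map_sum_sub_sq_ne_top m ρ hfin).and hmem).exists
  have hcont : Continuous fun x : ι → ℝ => ∑ i, (x i - t i) ^ 2 := by fun_prop
  have hD := (isCompact_univ_pi fun _ : ι => hC).image hcont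
  refine ⟨t, htC, volume_pos_of_lintegral_ft_sq_ne_top hD ?_ ?_ ht⟩
  · rw [Measure.map_apply hcont.measurable hD.measurableSet.compl]
    have hmem' : ∀ᵐ x ∂Measure.pi m, x ∈ univ.pi fun _ => C := by
      simp only [mem_univ_pi]
      exact eventually_all.2 fun i =>
        Measure.tendsto_eval_ae_ae.eventually (show ∀ᵐ x ∂m i, x ∈ C from (key i).2.2.1)
    exact measure_mono_null (fun x hx hxC => hx (mem_image_of_mem _ hxC)) hmem'
  · rw [Measure.map_apply hcont.measurable MeasurableSet.univ, preimage_univ, Measure.pi_univ]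
    exact Finset.prod_ne_zero_iff.2 fun i _ => (key i).2.2.2.2.1

theorem volume_pos_of_volume_image_sq_pos {S : Set ℝ}
    (h : 0 < volume ((fun d : ℝ => d ^ 2) '' S)) : 0 < volume S := by
  rw [pos_iff_ne_zero] at h ⊢
  exact fun h0 => h (addHaar_image_eq_zero_of_differentiableOn_of_addHaar_eq_zero volume
    (by fun_prop) h0)

end

/-- if `C ⊆ ℝ` is compact with `dim_H C > n/(2n-1)` and `A = C × ⋯ × C ⊆ ℝⁿ`,
then some pinned distance set `Δ_y(A)`, `y ∈ A`, has positive Lebesgue measure; in particular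
the distance set `Δ(A)` has positive Lebesgue measure. -/
theorem stmt_10 (n : ℕ) (hn : 2 ≤ n) (C : Set ℝ) (hC : IsCompact C)
    (hdim : dimH C > (n : ℝ≥0∞) / ((2 * n - 1 : ℕ) : ℝ≥0∞))
    (A : Set (EuclideanSpace ℝ (Fin n))) (hA : A = {x | ∀ i, x i ∈ C}) :
    (∃ y ∈ A, 0 < volume ((fun x => dist x y) '' A)) ∧
      0 < volume {d : ℝ | ∃ x ∈ A, ∃ y ∈ A, dist x y = d} := by
  have hpin : ∃ y ∈ A, 0 < volume ((fun x => dist x y) '' A) := by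
    obtain ⟨s, hs, hsC⟩ := ENNReal.lt_iff_exists_nnreal_btwn.1 hdim
    have : NeZero n := ⟨by lia⟩
    have hn0 : ((2 * n - 1 : ℕ) : ℝ≥0∞) ≠ 0 := by
      rw [Nat.cast_ne_zero]
      lia
    rw [ENNReal.div_lt_iff (Or.inl hn0) (Or.inl (ENNReal.natCast_ne_top _))] at hs
    have hsn : (n : ℝ) < s * (2 * n - 1) := by
      have h1 : (n : NNReal) < s * (2 * n - 1 : ℕ) := by exact_mod_cast hs
      have h2 : (n : ℝ) < s * (2 * n - 1 : ℕ) := by exact_mod_cast h1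
      rw [Nat.cast_sub (by lia)] at h2
      push_cast at h2
      exact h2
    have hs2 : 1 / 2 ≤ s := by
      have hn2 : (2 : ℝ) ≤ n := by exact_mod_cast hn
      rw [← NNReal.coe_le_coe]
      push_cast
      nlinarith
    obtain ⟨t, htC, ht⟩ := exists_volume_image_sum_sub_sq_pos (ι := Fin n) hC hs2 hsC
      (by simpa using hsn)
    refine ⟨WithLp.toLp 2 t, by simpa [hA] using htC, volume_pos_of_volume_image_sq_pos ?_⟩
    refine ht.trans_le (measure_mono ?_)
    rintro _ ⟨x, hx, rfl⟩
    refine ⟨_, ⟨WithLp.toLp 2 x, by simpa [hA] using hx, rfl⟩, ?_⟩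
    simp only [EuclideanSpace.dist_eq, Real.dist_eq, sq_abs]
    exact Real.sq_sqrt (by positivity)
  refine ⟨hpin, ?_⟩
  obtain ⟨y, hy, hpos⟩ := hpin
  refine hpos.trans_le (measure_mono ?_)
  rintro _ ⟨x, hx, rfl⟩
  exact ⟨x, hx, y, hy, rfl⟩
end
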